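/- arXiv:2510.21134 — 8 statements merged into one kernel-verified Lean document; each statement's English description precedes it below -/
import Mathlib

section
/- Let σ > 0, ρ = 2.2, K(u) = (σ/2)e^{−σ|u|}, and F(u) = (1+ρ)u − ρu². Set n_± = (ρ + 2 ± √(ρ²−4))/(2ρ), so that n_− < n_+ and F(n_±) = n_∓. Then there exist bounded continuous functions N₀, N₁ : ℝ → ℝ with N₁ = Q[N₀] and N₀ = Q[N₁], such that N₀ is not identically equal to N₁, lim_{x→−∞} N₀(x) = n_− = lim_{x→+∞} N₁(x), and lim_{x→+∞} N₀(x) = n_+ = lim_{x→−∞} N₁(x). In other words, the integrodifference equation N_{t+1} = Q[N_t] has a spatially inhomogeneous 2-cycle connecting n_− and n_+. -/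
open MeasureTheory Filter Real Set Topology

namespace IDE

/-- bounded measurable functions -/
def Good (f : ℝ → ℝ) : Prop := Measurable f ∧ ∃ C, ∀ x, |f x| ≤ C

noncomputable def AA (f : ℝ → ℝ) (x : ℝ) : ℝ := ∫ z in Ioi (0:ℝ), exp (-z) * f (x - z)
noncomputable def BB (f : ℝ → ℝ) (x : ℝ) : ℝ := ∫ z in Ioi (0:ℝ), exp (-z) * f (x + z)
noncomputable def LL (f : ℝ → ℝ) (x : ℝ) : ℝ := (AA f x + BB f x) / 2

lemma Good.comp_neg {f : ℝ → ℝ} (h : Good f) : Good (fun x => f (-x)) :=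
  ⟨h.1.comp measurable_neg, h.2.imp fun _ hC _ => hC _⟩

lemma BB_eq (f : ℝ → ℝ) (x : ℝ) : BB f x = AA (fun y => f (-y)) (-x) := by
  unfold BB AA
  congr 1; ext z; congr 2; ring

lemma intA {f : ℝ → ℝ} (h : Good f) (x : ℝ) :
    IntegrableOn (fun z => exp (-z) * f (x - z)) (Ioi 0) := by
  obtain ⟨hm, C, hC⟩ := h
  refine Integrable.mul_bdd (c := C) (integrableOn_exp_neg_Ioi 0) ?_ ?_
  · exact (hm.comp (measurable_const.sub measurable_id)).aestronglyMeasurable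
  · exact Eventually.of_forall fun z => hC _

lemma AA_mono {f g : ℝ → ℝ} (hf : Good f) (hg : Good g) (x y : ℝ)
    (h : ∀ z, 0 < z → f (x - z) ≤ g (y - z)) : AA f x ≤ AA g y := by
  refine setIntegral_mono_on (intA hf x) (intA hg y) measurableSet_Ioi fun z hz => ?_
  exact mul_le_mul_of_nonneg_left (h z hz) (exp_pos _).le

lemma AA_const (c x : ℝ) : AA (fun _ => c) x = c := by
  unfold AA
  rw [integral_mul_const, integral_exp_neg_Ioi_zero, one_mul]

lemma good_const (c : ℝ) : Good (fun _ => c) := ⟨measurable_const, |c|, fun _ => le_rfl⟩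

lemma BB_mono {f g : ℝ → ℝ} (hf : Good f) (hg : Good g) (x y : ℝ)
    (h : ∀ z, 0 < z → f (x + z) ≤ g (y + z)) : BB f x ≤ BB g y := by
  rw [BB_eq, BB_eq]
  refine AA_mono hf.comp_neg hg.comp_neg _ _ fun z hz => ?_
  simpa [add_comm] using h z hz

lemma BB_const (c x : ℝ) : BB (fun _ => c) x = c := by
  rw [BB_eq, AA_const]

lemma AA_lim {f : ℝ → ℝ} (hf : Good f) {l : ℝ} {F : Filter ℝ} [F.IsCountablyGenerated]
    (hF : ∀ z : ℝ, Tendsto (fun x => x - z) F F)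
    (h : Tendsto f F (𝓝 l)) : Tendsto (AA f) F (𝓝 l) := by
  obtain ⟨hm, C, hC⟩ := hf
  have : l = ∫ z in Ioi (0:ℝ), exp (-z) * l := by
    rw [integral_mul_const, integral_exp_neg_Ioi_zero, one_mul]
  rw [this]
  unfold AA
  refine tendsto_integral_filter_of_dominated_convergence (fun z => exp (-z) * C) ?_ ?_ ?_ ?_
  · refine Eventually.of_forall fun x => ?_
    exact ((by fun_prop : Measurable fun z : ℝ => exp (-z)).mul
      (hm.comp (measurable_const.sub measurable_id))).aestronglyMeasurable
  · refine Eventually.of_forall fun x => Eventually.of_forall fun z => ?_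
    rw [norm_mul, norm_of_nonneg (exp_pos _).le]
    exact mul_le_mul_of_nonneg_left (hC _) (exp_pos _).le
  · exact (integrableOn_exp_neg_Ioi 0).mul_const C
  · exact Eventually.of_forall fun z => (h.comp (hF z)).const_mul _

lemma AA_lim_top {f : ℝ → ℝ} (hf : Good f) {l : ℝ} (h : Tendsto f atTop (𝓝 l)) :
    Tendsto (AA f) atTop (𝓝 l) :=
  AA_lim hf (fun z => tendsto_atTop_add_const_right _ (-z) tendsto_id) h

lemma AA_lim_bot {f : ℝ → ℝ} (hf : Good f) {l : ℝ} (h : Tendsto f atBot (𝓝 l)) :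
    Tendsto (AA f) atBot (𝓝 l) :=
  AA_lim hf (fun z => tendsto_atBot_add_const_right _ (-z) tendsto_id) h

lemma BB_lim_top {f : ℝ → ℝ} (hf : Good f) {l : ℝ} (h : Tendsto f atTop (𝓝 l)) :
    Tendsto (BB f) atTop (𝓝 l) := by
  have := (AA_lim_bot hf.comp_neg (h.comp tendsto_neg_atBot_atTop)).comp tendsto_neg_atTop_atBot
  exact this.congr fun x => (BB_eq f x).symm

lemma BB_lim_bot {f : ℝ → ℝ} (hf : Good f) {l : ℝ} (h : Tendsto f atBot (𝓝 l)) :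
    Tendsto (BB f) atBot (𝓝 l) := by
  have := (AA_lim_top hf.comp_neg (h.comp tendsto_neg_atTop_atBot)).comp tendsto_neg_atBot_atTop
  exact this.congr fun x => (BB_eq f x).symm

lemma intE {f : ℝ → ℝ} (h : Good f) (x : ℝ) : IntegrableOn (fun y => exp y * f y) (Iic x) := by
  obtain ⟨hm, C, hC⟩ := h
  refine Integrable.mul_bdd (c := C) (integrableOn_exp_Iic x) ?_ ?_
  · exact hm.aestronglyMeasurable
  · exact Eventually.of_forall fun z => hC _

lemma AA_eq {f : ℝ → ℝ} (h : Good f) (x : ℝ) :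
    AA f x = exp (-x) * ((∫ y in Iic 0, exp y * f y) + ∫ y in (0:ℝ)..x, exp y * f y) := by
  rw [← intervalIntegral.integral_Iic_sub_Iic (intE h 0) (intE h x), add_sub_cancel]
  have h1 : ∫ z in Ioi (0:ℝ), exp (-z) * f (x - z) = ∫ y in Iic (0:ℝ), exp y * f (x + y) := by
    have := integral_comp_neg_Ioi (0:ℝ) (fun y => exp y * f (x + y))
    rw [neg_zero] at this
    rw [← this]; rfl
  have h2 : ∫ y in Iic x, exp y * f y = ∫ y in Iic (0:ℝ), exp (x + y) * f (x + y) := by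
    rw [← integral_indicator measurableSet_Iic, ← integral_indicator measurableSet_Iic,
      ← integral_add_left_eq_self _ x]
    congr 1; ext y
    simp [indicator]
  unfold AA
  rw [h1, h2, ← integral_const_mul]
  congr 1; ext y
  rw [← mul_assoc, ← exp_add]; congr 2; ring

lemma AA_cont {f : ℝ → ℝ} (h : Good f) : Continuous (AA f) := by
  rw [show AA f = _ from funext (AA_eq h)]
  have : Continuous fun x => ∫ y in (0:ℝ)..x, exp y * f y := by
    refine intervalIntegral.continuous_primitive (fun a b => ?_) 0
    exact ⟨(intE h b).mono_set Ioc_subset_Iic_self, (intE h a).mono_set Ioc_subset_Iic_self⟩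
  fun_prop

lemma BB_cont {f : ℝ → ℝ} (h : Good f) : Continuous (BB f) := by
  rw [show BB f = _ from funext (BB_eq f)]
  exact (AA_cont h.comp_neg).comp continuous_neg

lemma AA_deriv {f : ℝ → ℝ} (h : Good f) (hc : Continuous f) (x : ℝ) :
    HasDerivAt (AA f) (f x - AA f x) x := by
  have h1 : HasDerivAt (fun x => ∫ y in (0:ℝ)..x, exp y * f y) (exp x * f x) x :=
    intervalIntegral.integral_hasDerivAt_right ((by fun_prop : Continuous fun y => exp y * f y).intervalIntegrable _ _)
      ((by fun_prop : Continuous fun y => exp y * f y).stronglyMeasurableAtFilter _ _)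
      (by fun_prop : Continuous fun y => exp y * f y).continuousAt
  have h2 := (hasDerivAt_neg x).exp.mul (h1.const_add (∫ y in Iic 0, exp y * f y))
  rw [show AA f = _ from funext (AA_eq h)]
  refine h2.congr_deriv ?_
  have : exp (-x) * exp x = 1 := by rw [← exp_add]; simp
  linear_combination (f x) * this

lemma BB_deriv {f : ℝ → ℝ} (h : Good f) (hc : Continuous f) (x : ℝ) :
    HasDerivAt (BB f) (BB f x - f x) x := by
  have := (AA_deriv h.comp_neg (hc.comp continuous_neg) (-x)).comp x (hasDerivAt_neg x)
  rw [BB_eq, show BB f = _ from funext (BB_eq f)]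
  refine this.congr_deriv ?_
  simp

/-- the Laplace convolution -/
lemma LL_eq {f : ℝ → ℝ} (h : Good f) (x : ℝ) :
    ∫ y, (1 / 2 * exp (-|x - y|)) * f y = LL f x := by
  rw [← integral_sub_left_eq_self _ _ x]
  have e1 : ∀ z, (1 / 2 * exp (-|x - (x - z)|)) * f (x - z)
      = 1 / 2 * (exp (-|z|) * f (x - z)) := by
    intro z; rw [sub_sub_cancel]; ring
  simp_rw [e1]
  rw [integral_const_mul]
  have iP : IntegrableOn (fun z => exp (-|z|) * f (x - z)) (Ioi 0) := by
    refine (intA h x).congr_fun (fun z hz => ?_) measurableSet_Ioi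
    simp only [abs_of_pos (mem_Ioi.1 hz)]
  have iN : IntegrableOn (fun z => exp (-|z|) * f (x - z)) (Iic 0) := by
    have := intE (f := fun z => f (x - z)) ⟨h.1.comp (measurable_const.sub measurable_id),
      h.2.imp fun _ hC z => hC _⟩ 0
    refine this.congr_fun (fun z hz => ?_) measurableSet_Iic
    simp only [abs_of_nonpos (mem_Iic.1 hz), neg_neg]
  rw [← intervalIntegral.integral_Iic_add_Ioi iN iP]
  have hP : ∫ z in Ioi (0:ℝ), exp (-|z|) * f (x - z) = AA f x := by
    refine setIntegral_congr_fun measurableSet_Ioi fun z hz => ?_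
    simp only [abs_of_pos (mem_Ioi.1 hz)]
  have hN : ∫ z in Iic (0:ℝ), exp (-|z|) * f (x - z) = BB f x := by
    have := integral_comp_neg_Ioi (0:ℝ) (fun z => exp (-|z|) * f (x - z))
    rw [neg_zero] at this
    rw [← this]
    refine setIntegral_congr_fun measurableSet_Ioi fun z hz => ?_
    simp only [abs_neg, abs_of_pos (mem_Ioi.1 hz), sub_neg_eq_add]
  rw [hP, hN]; unfold LL; ring

lemma LL_mono {f g : ℝ → ℝ} (hf : Good f) (hg : Good g) (x y : ℝ)
    (h : ∀ z, f (x + z) ≤ g (y + z)) : LL f x ≤ LL g y := by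
  have h1 := AA_mono hf hg x y fun z _ => by simpa [sub_eq_add_neg] using h (-z)
  have h2 := BB_mono hf hg x y fun z _ => h z
  unfold LL; linarith

lemma LL_const (c x : ℝ) : LL (fun _ => c) x = c := by
  unfold LL; rw [AA_const, BB_const]; ring

lemma LL_cont {f : ℝ → ℝ} (h : Good f) : Continuous (LL f) := by
  have := AA_cont h
  have := BB_cont h
  unfold LL; fun_prop

lemma LL_lim_top {f : ℝ → ℝ} (hf : Good f) {l : ℝ} (h : Tendsto f atTop (𝓝 l)) :
    Tendsto (LL f) atTop (𝓝 l) := by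
  have := ((AA_lim_top hf h).add (BB_lim_top hf h)).div_const 2
  rwa [add_self_div_two] at this

lemma LL_lim_bot {f : ℝ → ℝ} (hf : Good f) {l : ℝ} (h : Tendsto f atBot (𝓝 l)) :
    Tendsto (LL f) atBot (𝓝 l) := by
  have := ((AA_lim_bot hf h).add (BB_lim_bot hf h)).div_const 2
  rwa [add_self_div_two] at this

/-- half difference, the derivative of `LL f` -/
noncomputable def DD (f : ℝ → ℝ) (x : ℝ) : ℝ := (BB f x - AA f x) / 2

lemma DD_lim_top {f : ℝ → ℝ} (hf : Good f) {l : ℝ} (h : Tendsto f atTop (𝓝 l)) :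
    Tendsto (DD f) atTop (𝓝 0) := by
  have := ((BB_lim_top hf h).sub (AA_lim_top hf h)).div_const 2
  rw [sub_self, zero_div] at this
  exact this

lemma DD_lim_bot {f : ℝ → ℝ} (hf : Good f) {l : ℝ} (h : Tendsto f atBot (𝓝 l)) :
    Tendsto (DD f) atBot (𝓝 0) := by
  have := ((BB_lim_bot hf h).sub (AA_lim_bot hf h)).div_const 2
  rw [sub_self, zero_div] at this
  exact this

lemma LL_deriv {f : ℝ → ℝ} (h : Good f) (hc : Continuous f) (x : ℝ) :
    HasDerivAt (LL f) (DD f x) x := by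
  refine (((AA_deriv h hc x).add (BB_deriv h hc x)).div_const 2).congr_deriv ?_
  unfold DD; ring

lemma DD_deriv {f : ℝ → ℝ} (h : Good f) (hc : Continuous f) (x : ℝ) :
    HasDerivAt (DD f) (LL f x - f x) x := by
  refine (((BB_deriv h hc x).sub (AA_deriv h hc x)).div_const 2).congr_deriv ?_
  unfold LL; ring

/-- logistic growth with `ρ = 2.2` -/
noncomputable def Fn (u : ℝ) : ℝ := 16 / 5 * u - 11 / 5 * u ^ 2
noncomputable def Gn (u : ℝ) : ℝ := 8 / 5 * u ^ 2 - 11 / 15 * u ^ 3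

/-- the two points of the non-spatial cycle -/
structure Par (a b : ℝ) : Prop where
  sum : a + b = 21 / 11
  prod : a * b = 105 / 121
  lt : a < b

lemma Par.a1 {a b : ℝ} (h : Par a b) : 37 / 50 < a := by
  obtain ⟨h1, h2, h3⟩ := h
  obtain rfl : b = 21 / 11 - a := by linarith
  nlinarith
lemma Par.a2 {a b : ℝ} (h : Par a b) : a < 3 / 4 := by
  obtain ⟨h1, h2, h3⟩ := h
  obtain rfl : b = 21 / 11 - a := by linarith
  nlinarith
lemma Par.b1 {a b : ℝ} (h : Par a b) : 23 / 20 < b := by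
  have := h.a2; have := h.sum; linarith
lemma Par.b2 {a b : ℝ} (h : Par a b) : b < 6 / 5 := by
  have := h.a1; have := h.sum; linarith

lemma Par.Fa {a b : ℝ} (h : Par a b) : Fn a = b := by
  obtain ⟨h1, h2, h3⟩ := h
  unfold Fn
  linear_combination (-11 / 5 * a - 1) * h1 + 11 / 5 * h2
lemma Par.Fb {a b : ℝ} (h : Par a b) : Fn b = a := by
  obtain ⟨h1, h2, h3⟩ := h
  unfold Fn
  linear_combination (-11 / 5 * b - 1) * h1 + 11 / 5 * h2

lemma Fn_anti {x y : ℝ} (hx : 37 / 50 < x) (h : x ≤ y) : Fn y ≤ Fn x := by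
  unfold Fn; nlinarith

lemma Fn_strict {x y : ℝ} (hx : 37 / 50 < x) (h : x < y) : Fn y < Fn x := by
  unfold Fn; nlinarith

lemma Par.Fmem {a b : ℝ} (h : Par a b) {x : ℝ} (hx : x ∈ Icc a b) : Fn x ∈ Icc a b := by
  have h1 := h.a1
  constructor
  · rw [← h.Fb]; exact Fn_anti (by linarith [hx.1]) hx.2
  · rw [← h.Fa]; exact Fn_anti h1 hx.1

lemma Par.FF {a b : ℝ} (h : Par a b) (x : ℝ) :
    Fn (Fn x) - x = (11 / 5) ^ 3 * (x * (x - 1) * (x - a) * (b - x)) := by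
  obtain ⟨h1, h2, h3⟩ := h
  have e : (x - a) * (b - x) = -x ^ 2 + 21 / 11 * x - 105 / 121 := by
    linear_combination x * h1 - h2
  have : x * (x - 1) * (x - a) * (b - x) = x * (x - 1) * ((x - a) * (b - x)) := by ring
  rw [this, e]; unfold Fn; ring

lemma Fn_cont : Continuous Fn := by unfold Fn; fun_prop

def MI (a b : ℝ) (u : ℝ → ℝ) : Prop := Monotone u ∧ ∀ x, u x ∈ Icc a b
def AI (a b : ℝ) (u : ℝ → ℝ) : Prop := Antitone u ∧ ∀ x, u x ∈ Icc a b

noncomputable def T (u : ℝ → ℝ) : ℝ → ℝ := LL (fun y => Fn (u y))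

lemma good_of {a b : ℝ} (h : Par a b) {u : ℝ → ℝ} (hm : Measurable u) (hu : ∀ x, u x ∈ Icc a b) :
    Good (fun y => Fn (u y)) := by
  refine ⟨Fn_cont.measurable.comp hm, b, fun x => ?_⟩
  have := h.Fmem (hu x)
  rw [abs_of_nonneg (by linarith [this.1, h.a1])]
  exact this.2

lemma MI.good {a b : ℝ} (h : Par a b) {u : ℝ → ℝ} (hu : MI a b u) :
    Good (fun y => Fn (u y)) := good_of h hu.1.measurable hu.2
lemma AI.good {a b : ℝ} (h : Par a b) {u : ℝ → ℝ} (hu : AI a b u) :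
    Good (fun y => Fn (u y)) := good_of h hu.1.measurable hu.2

lemma T_mem {a b : ℝ} (h : Par a b) {u : ℝ → ℝ} (hm : Measurable u) (hu : ∀ x, u x ∈ Icc a b)
    (x : ℝ) : T u x ∈ Icc a b := by
  constructor
  · rw [← LL_const a x]
    exact LL_mono (good_const a) (good_of h hm hu) _ _ fun z => (h.Fmem (hu _)).1
  · rw [← LL_const b x]
    exact LL_mono (good_of h hm hu) (good_const b) _ _ fun z => (h.Fmem (hu _)).2

lemma MI.T {a b : ℝ} (h : Par a b) {u : ℝ → ℝ} (hu : MI a b u) : AI a b (T u) := by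
  refine ⟨fun x y hxy => ?_, T_mem h hu.1.measurable hu.2⟩
  refine LL_mono (hu.good h) (hu.good h) _ _ fun z => ?_
  exact Fn_anti (by linarith [h.a1, (hu.2 (x + z)).1]) (hu.1 (by linarith))

lemma AI.T {a b : ℝ} (h : Par a b) {u : ℝ → ℝ} (hu : AI a b u) : MI a b (T u) := by
  refine ⟨fun x y hxy => ?_, T_mem h hu.1.measurable hu.2⟩
  refine LL_mono (hu.good h) (hu.good h) _ _ fun z => ?_
  exact Fn_anti (by linarith [h.a1, (hu.2 (y + z)).1]) (hu.1 (by linarith))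

lemma T_anti {a b : ℝ} (h : Par a b) {u v : ℝ → ℝ} (hu : Good (fun y => Fn (u y)))
    (hv : Good (fun y => Fn (v y))) (ha : ∀ x, u x ∈ Icc a b)
    (huv : ∀ x, u x ≤ v x) (x : ℝ) : T v x ≤ T u x :=
  LL_mono hv hu _ _ fun z => Fn_anti (by linarith [h.a1, (ha (x + z)).1]) (huv _)

noncomputable def cp (b x : ℝ) : ℝ := max (49 / 50) (min b (b + x))
noncomputable def fl (a l x : ℝ) : ℝ := min (51 / 50) (max a (a + x - l))
noncomputable def clamp (a b l x w : ℝ) : ℝ := max (fl a l x) (min w (cp b x))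

lemma fix_aux {α β : Type*} [Preorder α] [CompleteLattice β] (Φ : (α →o β) →o (α →o β)) :
    ∃ u, Φ u = u := ⟨_, Φ.map_lfp⟩

lemma exists_fix {a b : ℝ} (h : Par a b) (l : ℝ) :
    ∃ u, MI a b u ∧ ∀ x, u x = clamp a b l x (T (T u) x) := by
  have : Fact (a ≤ b) := ⟨h.lt.le⟩
  have a1 := h.a1
  have a2 := h.a2
  have b1 := h.b1
  have hMI : ∀ u : ℝ →o Icc a b, MI a b (fun x => (u x : ℝ)) := fun u =>
    ⟨fun x y hxy => u.monotone hxy, fun x => (u x).2⟩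
  have hin : ∀ (u : ℝ →o Icc a b) x, clamp a b l x (T (T (fun x => (u x : ℝ))) x) ∈ Icc a b := by
    intro u x
    have hw := (((hMI u).T h).T h).2 x
    constructor
    · exact le_max_of_le_left (le_min (by linarith) (le_max_left _ _))
    · exact max_le (min_le_of_left_le (by linarith)) (min_le_of_left_le hw.2)
  have hmx : ∀ (u : ℝ →o Icc a b) x y, x ≤ y → clamp a b l x (T (T (fun x => (u x : ℝ))) x) ≤
      clamp a b l y (T (T (fun x => (u x : ℝ))) y) := by
    intro u x y hxy
    have hw := (((hMI u).T h).T h).1 hxy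
    unfold clamp fl cp
    gcongr
  have hmu : ∀ (u u' : ℝ →o Icc a b) x, u ≤ u' → clamp a b l x (T (T (fun x => (u x : ℝ))) x) ≤
      clamp a b l x (T (T (fun x => (u' x : ℝ))) x) := by
    intro u u' x huu
    have e1 : ∀ x, T (fun x => (u' x : ℝ)) x ≤ T (fun x => (u x : ℝ)) x :=
      T_anti h ((hMI u).good h) ((hMI u').good h) (hMI u).2 (fun x => huu x)
    have e2 : T (T (fun x => (u x : ℝ))) x ≤ T (T (fun x => (u' x : ℝ))) x :=
      T_anti h (((hMI u').T h).good h) (((hMI u).T h).good h) ((hMI u').T h).2 e1 x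
    unfold clamp
    gcongr
  let Φ : (ℝ →o Icc a b) →o (ℝ →o Icc a b) :=
    { toFun := fun u =>
        { toFun := fun x => ⟨clamp a b l x (T (T (fun x => (u x : ℝ))) x), hin u x⟩
          monotone' := fun x y hxy => hmx u x y hxy }
      monotone' := fun u u' huu x => hmu u u' x huu }
  obtain ⟨u, hu⟩ : ∃ u, Φ u = u := 
    @fix_aux ℝ (Icc a b) _ Set.Icc.completeLattice Φ
  refine ⟨fun x => (u x : ℝ), hMI _, fun x => ?_⟩
  conv_lhs => rw [← hu]
  rfl

lemma lim_top {a b : ℝ} (h : Par a b) {l : ℝ} {u : ℝ → ℝ} (hu : MI a b u)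
    (e : ∀ x, u x = clamp a b l x (T (T u) x)) :
    Tendsto u atTop (𝓝 b) ∧ Tendsto (T u) atTop (𝓝 a) ∧ Tendsto (T (T u)) atTop (𝓝 b) := by
  have a1 := h.a1
  have a2 := h.a2
  have b1 := h.b1
  obtain ⟨L, hL⟩ : ∃ L, Tendsto u atTop (𝓝 L) :=
    ⟨_, tendsto_atTop_ciSup hu.1 ⟨b, by rintro _ ⟨x, rfl⟩; exact (hu.2 x).2⟩⟩
  have hmem : L ∈ Icc a b := isClosed_Icc.mem_of_tendsto hL (Eventually.of_forall hu.2)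
  have h1 : Tendsto (T u) atTop (𝓝 (Fn L)) :=
    LL_lim_top (hu.good h) ((Fn_cont.tendsto L).comp hL)
  have h2 : Tendsto (T (T u)) atTop (𝓝 (Fn (Fn L))) :=
    LL_lim_top ((hu.T h).good h) ((Fn_cont.tendsto _).comp h1)
  have h3 : Tendsto u atTop (𝓝 (max (51 / 50) (Fn (Fn L)))) := by
    refine Tendsto.congr' ?_ (tendsto_const_nhds.max h2)
    filter_upwards [eventually_ge_atTop (max 0 (l + 1))] with x hx
    rw [e]
    have hx0 : 0 ≤ x := le_trans (le_max_left _ _) hx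
    have hx1 : l + 1 ≤ x := le_trans (le_max_right _ _) hx
    have hb := (((hu.T h).T h).2 x).2
    have c1 : cp b x = b := by
      unfold cp; rw [min_eq_left (by linarith), max_eq_right (by linarith)]
    have c2 : fl a l x = 51 / 50 := by
      unfold fl; rw [min_eq_left (le_max_of_le_right (by linarith))]
    unfold clamp
    rw [c1, c2, min_eq_left hb]
  have h4 := tendsto_nhds_unique hL h3
  have hLb : L = b := by
    have hF := h.FF L
    have g1 : 51 / 50 ≤ L := (le_max_left _ _).trans_eq h4.symm
    have g2 : Fn (Fn L) ≤ L := (le_max_right _ _).trans_eq h4.symm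
    by_contra hne
    have hlt : L < b := lt_of_le_of_ne hmem.2 hne
    have : 0 < L * (L - 1) * (L - a) * (b - L) := by
      have : 0 < L := by linarith
      have : 0 < L - 1 := by linarith
      have : 0 < L - a := by linarith
      have : 0 < b - L := by linarith
      positivity
    linarith
  rw [hLb] at hL h1 h2
  rw [h.Fb] at h1 h2
  rw [h.Fa] at h2
  exact ⟨hL, h1, h2⟩

lemma lim_bot {a b : ℝ} (h : Par a b) {l : ℝ} {u : ℝ → ℝ} (hu : MI a b u)
    (e : ∀ x, u x = clamp a b l x (T (T u) x)) :
    Tendsto u atBot (𝓝 a) ∧ Tendsto (T u) atBot (𝓝 b) ∧ Tendsto (T (T u)) atBot (𝓝 a) := by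
  have a1 := h.a1
  have a2 := h.a2
  have b1 := h.b1
  have b2 := h.b2
  obtain ⟨L, hL⟩ : ∃ L, Tendsto u atBot (𝓝 L) :=
    ⟨_, tendsto_atBot_ciInf hu.1 ⟨a, by rintro _ ⟨x, rfl⟩; exact (hu.2 x).1⟩⟩
  have hmem : L ∈ Icc a b := isClosed_Icc.mem_of_tendsto hL (Eventually.of_forall hu.2)
  have h1 : Tendsto (T u) atBot (𝓝 (Fn L)) :=
    LL_lim_bot (hu.good h) ((Fn_cont.tendsto L).comp hL)
  have h2 : Tendsto (T (T u)) atBot (𝓝 (Fn (Fn L))) :=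
    LL_lim_bot ((hu.T h).good h) ((Fn_cont.tendsto _).comp h1)
  have h3 : Tendsto u atBot (𝓝 (min (Fn (Fn L)) (49 / 50))) := by
    refine Tendsto.congr' ?_ (h2.min tendsto_const_nhds)
    filter_upwards [eventually_le_atBot (min (-1) l)] with x hx
    rw [e]
    have hx0 : x ≤ -1 := le_trans hx (min_le_left _ _)
    have hx1 : x ≤ l := le_trans hx (min_le_right _ _)
    have hb := (((hu.T h).T h).2 x).1
    have c1 : cp b x = 49 / 50 := by
      unfold cp; rw [max_eq_left (min_le_of_right_le (by linarith))]
    have c2 : fl a l x = a := by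
      unfold fl; rw [max_eq_left (by linarith), min_eq_right (by linarith)]
    unfold clamp
    rw [c1, c2, max_eq_right (le_min hb (by linarith))]
  have h4 := tendsto_nhds_unique hL h3
  have hLb : L = a := by
    have hF := h.FF L
    have g1 : L ≤ 49 / 50 := h4.trans_le (min_le_right _ _)
    have g2 : L ≤ Fn (Fn L) := h4.trans_le (min_le_left _ _)
    by_contra hne
    have hlt : a < L := lt_of_le_of_ne hmem.1 (Ne.symm hne)
    have : 0 < L * (1 - L) * (L - a) * (b - L) := by
      have : 0 < L := by linarith
      have : 0 < 1 - L := by linarith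
      have : 0 < L - a := by linarith
      have : 0 < b - L := by linarith
      positivity
    have e2 : L * (L - 1) * (L - a) * (b - L) = - (L * (1 - L) * (L - a) * (b - L)) := by ring
    linarith
  rw [hLb] at hL h1 h2
  rw [h.Fa] at h1 h2
  rw [h.Fb] at h2
  exact ⟨hL, h1, h2⟩

lemma Gn_deriv {f : ℝ → ℝ} {f' x : ℝ} (hf : HasDerivAt f f' x) :
    HasDerivAt (fun x => Gn (f x)) (Fn (f x) * f') x := by
  unfold Gn
  refine (((hf.pow 2).const_mul (8 / 5)).sub ((hf.pow 3).const_mul (11 / 15))).congr_deriv ?_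
  unfold Fn; simp; ring

lemma Gn_cont : Continuous Gn := by unfold Gn; fun_prop

/-- the energy -/
noncomputable def HH (u : ℝ → ℝ) (x : ℝ) : ℝ :=
  DD (fun y => Fn (T u y)) x * DD (fun y => Fn (u y)) x - T (T u) x * T u x
    + Gn (T (T u) x) + Gn (T u x)

section
variable {a b l : ℝ} {u : ℝ → ℝ}

lemma cp_cont : Continuous (cp b) := by unfold cp; fun_prop
lemma fl_cont : Continuous (fl a l) := by unfold fl; fun_prop

lemma v_cont (h : Par a b) (hu : MI a b u) : Continuous (T u) := LL_cont (hu.good h)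
lemma w_cont (h : Par a b) (hu : MI a b u) : Continuous (T (T u)) := LL_cont ((hu.T h).good h)

lemma u_cont (h : Par a b) (hu : MI a b u) (e : ∀ x, u x = clamp a b l x (T (T u) x)) :
    Continuous u := by
  have h1 := w_cont h hu
  have h2 : Continuous (cp b) := cp_cont
  have h3 : Continuous (fl a l) := fl_cont
  rw [funext e]; unfold clamp
  exact h3.max (h1.min h2)

lemma w_deriv (h : Par a b) (hu : MI a b u) (x : ℝ) :
    HasDerivAt (T (T u)) (DD (fun y => Fn (T u y)) x) x :=
  LL_deriv ((hu.T h).good h) (Fn_cont.comp (v_cont h hu)) x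

lemma v_deriv (h : Par a b) (hu : MI a b u) (hc : Continuous u) (x : ℝ) :
    HasDerivAt (T u) (DD (fun y => Fn (u y)) x) x :=
  LL_deriv (hu.good h) (Fn_cont.comp hc) x

lemma w_nonneg (h : Par a b) (hu : MI a b u) (x : ℝ) : 0 ≤ DD (fun y => Fn (T u y)) x := by
  rw [← (w_deriv h hu x).deriv]
  exact (((hu.T h).T h).1).deriv_nonneg

lemma HH_deriv (h : Par a b) (hu : MI a b u) (hc : Continuous u) (x : ℝ) :
    HasDerivAt (HH u) (DD (fun y => Fn (T u y)) x * (Fn (T (T u) x) - Fn (u x))) x := by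
  have hw := w_deriv h hu x
  have hv := v_deriv h hu hc x
  have hw2 := DD_deriv ((hu.T h).good h) (Fn_cont.comp (v_cont h hu)) x
  have hv2 := DD_deriv (hu.good h) (Fn_cont.comp hc) x
  refine ((((hw2.mul hv2).sub (hw.mul hv)).add (Gn_deriv hw)).add (Gn_deriv hv)).congr_deriv ?_
  change (T (T u) x - Fn (T u x)) * DD (fun y => Fn (u y)) x
    + DD (fun y => Fn (T u y)) x * (T u x - Fn (u x)) - _ + _ + _ = _
  ring

noncomputable def H0 (a b : ℝ) : ℝ := - (b * a) + Gn b + Gn a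

lemma HH_top (h : Par a b) (hu : MI a b u) (e : ∀ x, u x = clamp a b l x (T (T u) x)) :
    Tendsto (HH u) atTop (𝓝 (H0 a b)) := by
  obtain ⟨h1, h2, h3⟩ := lim_top h hu e
  have d1 := DD_lim_top ((hu.T h).good h) ((Fn_cont.tendsto _).comp h2)
  have d2 := DD_lim_top (hu.good h) ((Fn_cont.tendsto _).comp h1)
  have := (((d1.mul d2).sub (h3.mul h2)).add ((Gn_cont.tendsto _).comp h3)).add
    ((Gn_cont.tendsto _).comp h2)
  have e2 : H0 a b = 0 * 0 - b * a + Gn b + Gn a := by unfold H0; ring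
  rw [e2]; exact this

lemma HH_bot (h : Par a b) (hu : MI a b u) (e : ∀ x, u x = clamp a b l x (T (T u) x)) :
    Tendsto (HH u) atBot (𝓝 (H0 a b)) := by
  obtain ⟨h1, h2, h3⟩ := lim_bot h hu e
  have d1 := DD_lim_bot ((hu.T h).good h) ((Fn_cont.tendsto _).comp h2)
  have d2 := DD_lim_bot (hu.good h) ((Fn_cont.tendsto _).comp h1)
  have := (((d1.mul d2).sub (h3.mul h2)).add ((Gn_cont.tendsto _).comp h3)).add
    ((Gn_cont.tendsto _).comp h2)
  have e2 : H0 a b = 0 * 0 - a * b + Gn a + Gn b := by unfold H0; ring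
  rw [e2]; exact this

lemma const_zero {f f' : ℝ → ℝ} {c : ℝ} (hf : ∀ x, HasDerivAt f (f' x) x)
    (hp : ∀ x, 0 ≤ f' x) (ht : Tendsto f atTop (𝓝 c)) (hb : Tendsto f atBot (𝓝 c)) (x : ℝ) :
    f' x = 0 := by
  have hm : Monotone f := monotone_of_deriv_nonneg (fun x => (hf x).differentiableAt)
    fun x => by rw [(hf x).deriv]; exact hp x
  have : f = fun _ => c := funext fun y => le_antisymm (hm.ge_of_tendsto ht y) (hm.le_of_tendsto hb y)
  have h2 := hf x
  rw [this] at h2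
  exact h2.unique (hasDerivAt_const x c)

lemma fl_le (_ : Par a b) (x : ℝ) : fl a l x ≤ 51 / 50 := min_le_left _ _
lemma le_cp (x : ℝ) : 49 / 50 ≤ cp b x := le_max_left _ _
lemma fl_mono : Monotone (fl a l) := by
  intro x y hxy; unfold fl; gcongr
lemma cp_mono : Monotone (cp b) := by
  intro x y hxy; unfold cp; gcongr

lemma cp_pos (h : Par a b) {x : ℝ} (hx : 0 ≤ x) : cp b x = b := by
  have := h.b1
  unfold cp; rw [min_eq_left (by linarith), max_eq_right (by linarith)]
lemma fl_neg (h : Par a b) {x : ℝ} (hx : x ≤ l) : fl a l x = a := by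
  have := h.a2
  unfold fl; rw [max_eq_left (by linarith), min_eq_right (by linarith)]

lemma caseA (h : Par a b) (hu : MI a b u) (e : ∀ x, u x = clamp a b l x (T (T u) x))
    (hA : ∀ x, T (T u) x ≤ cp b x) : T (T u) = u := by
  have hc := u_cont h hu e
  have hw := (hu.T h).T h
  have a1 := h.a1
  have b1 := h.b1
  have e' : ∀ x, u x = max (fl a l x) (T (T u) x) := fun x => by
    rw [e x]; unfold clamp; rw [min_eq_left (hA x)]
  have hz := const_zero (HH_deriv h hu hc) (fun x => mul_nonneg (w_nonneg h hu x)
    (sub_nonneg.2 (Fn_anti (by linarith [(hw.2 x).1]) ((le_max_right _ _).trans_eq (e' x).symm))))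
    (HH_top h hu e) (HH_bot h hu e)
  have key : ∀ x, fl a l x ≤ T (T u) x := by
    by_contra! hcon
    obtain ⟨x0, hx0⟩ := hcon
    have hk := fl_le (l := l) h x0
    have hev := (lim_top h hu e).2.2.eventually (lt_mem_nhds (show 51 / 50 < b by linarith))
    obtain ⟨x1, hx1, hx01⟩ := (hev.and (eventually_gt_atTop x0)).exists
    obtain ⟨y, hy, hwy⟩ := intermediate_value_Icc hx01.le (w_cont h hu).continuousOn
      (show (T (T u) x0 + fl a l x0) / 2 ∈ _ from ⟨by linarith, by linarith⟩)
    have hxy : x0 < y := by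
      rcases hy.1.eq_or_lt with h0 | h0
      · rw [← h0] at hwy; linarith
      · exact h0
    obtain ⟨ξ, hξ, hs⟩ := exists_hasDerivAt_eq_slope _ _ hxy (w_cont h hu).continuousOn
      (fun x _ => w_deriv h hu x)
    have hpos : 0 < DD (fun y => Fn (T u y)) ξ := by
      rw [hs]; exact div_pos (by linarith) (by linarith)
    have h1 : T (T u) ξ < u ξ := by
      have := hw.1 hξ.2.le
      have h2 := fl_mono (a := a) (l := l) hξ.1.le
      have h3 : fl a l ξ ≤ u ξ := (le_max_left _ _).trans_eq (e' ξ).symm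
      linarith
    have h2 := Fn_strict (by linarith [(hw.2 ξ).1]) h1
    have h3 := hz ξ
    have h4 := mul_pos hpos (sub_pos.2 h2)
    linarith
  funext x
  rw [e' x, max_eq_right (key x)]

lemma caseB (h : Par a b) (hu : MI a b u) (e : ∀ x, u x = clamp a b l x (T (T u) x))
    (hl : 0 ≤ l) (hB : ∀ x, fl a l x ≤ T (T u) x) : T (T u) = u := by
  have hc := u_cont h hu e
  have hw := (hu.T h).T h
  have a1 := h.a1
  have a2 := h.a2
  have b1 := h.b1
  have hfc : ∀ x, fl a l x ≤ cp b x := by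
    intro x
    rcases le_total x l with hx | hx
    · rw [fl_neg h hx]; linarith [le_cp (b := b) x]
    · rw [cp_pos h (hl.trans hx)]; linarith [fl_le (l := l) h x]
  have e' : ∀ x, u x = min (T (T u) x) (cp b x) := fun x => by
    rw [e x]; unfold clamp; rw [max_eq_right (le_min (hB x) (hfc x))]
  have hz := const_zero (fun x => (HH_deriv h hu hc x).neg) (fun x => by
      have := mul_nonneg (w_nonneg h hu x)
        (sub_nonneg.2 (Fn_anti (by linarith [(hu.2 x).1]) ((e' x).trans_le (min_le_left _ _))))
      linarith)
    (HH_top h hu e).neg (HH_bot h hu e).neg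
  have key : ∀ x, T (T u) x ≤ cp b x := by
    by_contra! hcon
    obtain ⟨x0, hx0⟩ := hcon
    have hk := le_cp (b := b) x0
    have hev := (lim_bot h hu e).2.2.eventually (gt_mem_nhds (show a < 49 / 50 by linarith))
    obtain ⟨x1, hx1, hx01⟩ := (hev.and (eventually_lt_atBot x0)).exists
    obtain ⟨y, hy, hwy⟩ := intermediate_value_Icc hx01.le (w_cont h hu).continuousOn
      (show (T (T u) x0 + cp b x0) / 2 ∈ _ from ⟨by linarith, by linarith⟩)
    have hxy : y < x0 := by
      rcases hy.2.eq_or_lt with h0 | h0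
      · rw [h0] at hwy; linarith
      · exact h0
    obtain ⟨ξ, hξ, hs⟩ := exists_hasDerivAt_eq_slope _ _ hxy (w_cont h hu).continuousOn
      (fun x _ => w_deriv h hu x)
    have hpos : 0 < DD (fun y => Fn (T u y)) ξ := by
      rw [hs]; exact div_pos (by linarith) (by linarith)
    have h1 : u ξ < T (T u) ξ := by
      have := hw.1 hξ.1.le
      have h2 := cp_mono (b := b) hξ.2.le
      have h3 : u ξ ≤ cp b ξ := (e' ξ).trans_le (min_le_right _ _)
      linarith
    have h2 := Fn_strict (by linarith [(hu.2 ξ).1]) h1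
    have h3 := hz ξ
    have h4 := mul_pos hpos (sub_pos.2 h2)
    linarith
  funext x
  rw [e' x, min_eq_left (key x)]

lemma energy_gap (h : Par a b) {w v : ℝ} (hw1 : 49 / 50 ≤ w) (hw2 : w ≤ 51 / 50)
    (hv1 : 97 / 100 ≤ v) (hv2 : v ≤ 103 / 100) :
    H0 a b + 1 / 500 ≤ - (w * v) + Gn w + Gn v := by
  have e0 : H0 a b = 441 / 605 := by
    obtain ⟨h1, h2, h3⟩ := h
    obtain rfl : b = 21 / 11 - a := by linarith
    unfold H0 Gn
    ring
  rw [e0]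
  obtain ⟨p, rfl⟩ : ∃ p, w = 1 + p := ⟨w - 1, by ring⟩
  obtain ⟨q, rfl⟩ : ∃ q, v = 1 + q := ⟨v - 1, by ring⟩
  have e1 : - ((1 + p) * (1 + q)) + Gn (1 + p) + Gn (1 + q)
    = 11 / 15 - p * q - 3 / 5 * p ^ 2 - 3 / 5 * q ^ 2 - 11 / 15 * (p ^ 2 * p) - 11 / 15 * (q ^ 2 * q) := by
    unfold Gn; ring
  rw [e1]
  have p2 : p ^ 2 ≤ 1 / 2500 := by nlinarith
  have q2 : q ^ 2 ≤ 9 / 10000 := by nlinarith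
  have p3 : p ^ 2 * p ≤ p ^ 2 * (1 / 50) := mul_le_mul_of_nonneg_left (by linarith) (sq_nonneg _)
  have q3 : q ^ 2 * q ≤ q ^ 2 * (3 / 100) := mul_le_mul_of_nonneg_left (by linarith) (sq_nonneg _)
  nlinarith [sq_nonneg (p - q)]

lemma caseC (h : Par a b) {M : ℝ} (hM : 0 ≤ M)
    (hM1 : ∀ x, M ≤ x → LL (fun y => if y < 0 then b else Fn (49 / 50)) x ≤ 103 / 100)
    (hM2 : ∀ x, x ≤ -M → 97 / 100 ≤ LL (fun y => if y < 0 then Fn (51 / 50) else a) x)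
    (hl : l = 2 * M + 2)
    (hu : MI a b u) (e : ∀ x, u x = clamp a b l x (T (T u) x))
    (hA : ∃ x, cp b x < T (T u) x) (hB : ∃ x, T (T u) x < fl a l x) : False := by
  have hc := u_cont h hu e
  have hw := (hu.T h).T h
  have hv := hu.T h
  have a1 := h.a1
  have a2 := h.a2
  have b1 := h.b1
  have b2 := h.b2
  have w0 : 49 / 50 ≤ T (T u) 0 := by
    obtain ⟨x, hx⟩ := hA
    have hx0 : x ≤ 0 := by
      by_contra! hcon
      rw [cp_pos h hcon.le] at hx
      linarith [(hw.2 x).2]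
    linarith [hw.1 hx0, le_cp (b := b) x]
  have wl : T (T u) l ≤ 51 / 50 := by
    obtain ⟨x, hx⟩ := hB
    have hx0 : l ≤ x := by
      by_contra! hcon
      rw [fl_neg h hcon.le] at hx
      linarith [(hw.2 x).1]
    linarith [hw.1 hx0, fl_le (l := l) h x]
  have ule : ∀ x, x ≤ l → u x ≤ T (T u) x := by
    intro x hx
    rw [e x]; unfold clamp; rw [fl_neg h hx]
    exact max_le (hw.2 x).1 (min_le_left _ _)
  have leu : ∀ x, 0 ≤ x → T (T u) x ≤ u x := by
    intro x hx
    rw [e x]; unfold clamp; rw [cp_pos h hx]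
    exact le_max_of_le_right (le_min le_rfl (hw.2 x).2)
  have hanti : AntitoneOn (HH u) (Iic l) := by
    refine antitoneOn_of_deriv_nonpos (convex_Iic l)
      (fun x _ => (HH_deriv h hu hc x).continuousAt.continuousWithinAt)
      (fun x _ => (HH_deriv h hu hc x).differentiableAt.differentiableWithinAt) fun x hx => ?_
    rw [interior_Iic] at hx
    rw [(HH_deriv h hu hc x).deriv]
    exact mul_nonpos_of_nonneg_of_nonpos (w_nonneg h hu x)
      (sub_nonpos.2 (Fn_anti (by linarith [(hu.2 x).1]) (ule x (le_of_lt hx))))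
  have hH : ∀ x, x ≤ l → HH u x ≤ H0 a b := by
    intro x hx
    refine ge_of_tendsto (HH_bot h hu e) ?_
    filter_upwards [eventually_le_atBot x] with y hy
    exact hanti (hy.trans hx) hx hy
  have mem1 : Fn (49 / 50) ∈ Icc a b := h.Fmem ⟨by linarith, by linarith⟩
  have mem2 : Fn (51 / 50) ∈ Icc a b := h.Fmem ⟨by linarith, by linarith⟩
  have good1 : Good (fun y => if y < 0 then b else Fn (49 / 50)) := by
    refine ⟨Measurable.ite measurableSet_Iio measurable_const measurable_const, b, fun x => ?_⟩
    dsimp only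
    split_ifs
    · rw [abs_of_nonneg (by linarith)]
    · rw [abs_of_nonneg (by linarith [mem1.1])]; exact mem1.2
  have good2 : Good (fun y => if y < 0 then Fn (51 / 50) else a) := by
    refine ⟨Measurable.ite measurableSet_Iio measurable_const measurable_const, b, fun x => ?_⟩
    dsimp only
    split_ifs
    · rw [abs_of_nonneg (by linarith [mem2.1])]; exact mem2.2
    · rw [abs_of_nonneg (by linarith)]; exact h.lt.le
  have v1 : ∀ x, M ≤ x → T u x ≤ 103 / 100 := by
    intro x hx
    refine le_trans (LL_mono (hu.good h) good1 x x fun z => ?_) (hM1 x hx)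
    split_ifs with hz
    · exact (h.Fmem (hu.2 _)).2
    · push Not at hz
      exact Fn_anti (by norm_num) (by linarith [leu _ hz, hw.1 hz])
  have v2 : ∀ x, x ≤ l - M → 97 / 100 ≤ T u x := by
    intro x hx
    refine le_trans (hM2 (x - l) (by linarith)) (LL_mono good2 (hu.good h) (x - l) x fun z => ?_)
    split_ifs with hz
    · have : x + z ≤ l := by linarith
      exact Fn_anti (by linarith [(hu.2 (x + z)).1]) (by linarith [ule _ this, hw.1 this])
    · exact (h.Fmem (hu.2 _)).1
  have hMl : M < M + 2 := by linarith
  obtain ⟨ξ, hξ, hs⟩ := exists_hasDerivAt_eq_slope (fun x => T (T u) x - T u x) _ hMl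
    ((w_cont h hu).sub (v_cont h hu)).continuousOn
    (fun x _ => (w_deriv h hu x).sub (v_deriv h hu hc x))
  have w1 : ∀ x, M ≤ x → x ≤ M + 2 → 49 / 50 ≤ T (T u) x ∧ T (T u) x ≤ 51 / 50 := by
    intro x h1 h2
    exact ⟨w0.trans (hw.1 (by linarith)), (hw.1 (by linarith)).trans wl⟩
  have gap := energy_gap h (w1 ξ hξ.1.le hξ.2.le).1 (w1 ξ hξ.1.le hξ.2.le).2
    (v2 ξ (by linarith [hξ.2])) (v1 ξ hξ.1.le)
  have hHξ := hH ξ (by linarith [hξ.2])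
  unfold HH at hHξ
  have hwn := w_nonneg h hu ξ
  rw [show M + 2 - M = 2 by ring, eq_div_iff (by norm_num)] at hs
  have A1 := w1 M le_rfl (by linarith)
  have A2 := w1 (M + 2) (by linarith) le_rfl
  have B1 := v1 M le_rfl
  have B2 := v2 (M + 2) (by linarith)
  set p := DD (fun y => Fn (T u y)) ξ
  set q := DD (fun y => Fn (u y)) ξ
  have s1 : p - q ≤ 1 / 20 := by linarith [A1.1, A2.2]
  have s2 : p * q ≤ -1 / 500 := by linarith
  have s3 : q ≤ 0 := by
    by_contra! hcon
    nlinarith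
  nlinarith [sq_nonneg (p + q)]

lemma main (h : Par a b) : ∃ u v : ℝ → ℝ, Continuous u ∧ Continuous v ∧
    (∀ x, u x ∈ Icc a b) ∧ (∀ x, v x ∈ Icc a b) ∧ v = T u ∧ u = T v ∧
    Tendsto u atBot (𝓝 a) ∧ Tendsto v atTop (𝓝 a) ∧
    Tendsto u atTop (𝓝 b) ∧ Tendsto v atBot (𝓝 b) := by
  have a1 := h.a1
  have a2 := h.a2
  have b1 := h.b1
  have b2 := h.b2
  have mem1 : Fn (49 / 50) ∈ Icc a b := h.Fmem ⟨by linarith, by linarith⟩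
  have mem2 : Fn (51 / 50) ∈ Icc a b := h.Fmem ⟨by linarith, by linarith⟩
  have good1 : Good (fun y => if y < 0 then b else Fn (49 / 50)) := by
    refine ⟨Measurable.ite measurableSet_Iio measurable_const measurable_const, b, fun x => ?_⟩
    dsimp only
    split_ifs
    · rw [abs_of_nonneg (by linarith)]
    · rw [abs_of_nonneg (by linarith [mem1.1])]; exact mem1.2
  have good2 : Good (fun y => if y < 0 then Fn (51 / 50) else a) := by
    refine ⟨Measurable.ite measurableSet_Iio measurable_const measurable_const, b, fun x => ?_⟩
    dsimp only
    split_ifs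
    · rw [abs_of_nonneg (by linarith [mem2.1])]; exact mem2.2
    · rw [abs_of_nonneg (by linarith)]; exact h.lt.le
  have t1 : Tendsto (LL (fun y => if y < 0 then b else Fn (49 / 50))) atTop (𝓝 (Fn (49 / 50))) := by
    refine LL_lim_top good1 (tendsto_const_nhds.congr' ?_)
    filter_upwards [eventually_ge_atTop 0] with x hx
    rw [if_neg (not_lt.2 hx)]
  have t2 : Tendsto (LL (fun y => if y < 0 then Fn (51 / 50) else a)) atBot (𝓝 (Fn (51 / 50))) := by
    refine LL_lim_bot good2 (tendsto_const_nhds.congr' ?_)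
    filter_upwards [eventually_lt_atBot 0] with x hx
    rw [if_pos hx]
  obtain ⟨M1, hM1⟩ := eventually_atTop.1
    (t1.eventually (gt_mem_nhds (show Fn (49 / 50) < 103 / 100 by unfold Fn; norm_num)))
  obtain ⟨M2, hM2⟩ := eventually_atBot.1
    (t2.eventually (lt_mem_nhds (show 97 / 100 < Fn (51 / 50) by unfold Fn; norm_num)))
  set M := max 0 (max M1 (-M2)) with hMdef
  have m0 : 0 ≤ M := le_max_left _ _
  have m1 : M1 ≤ M := (le_max_left _ _).trans (le_max_right _ _)
  have m2 : -M2 ≤ M := (le_max_right _ _).trans (le_max_right _ _)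
  obtain ⟨u, hu, e⟩ := exists_fix h (2 * M + 2)
  have hfix : T (T u) = u := by
    by_cases hA : ∀ x, T (T u) x ≤ cp b x
    · exact caseA h hu e hA
    by_cases hB : ∀ x, fl a (2 * M + 2) x ≤ T (T u) x
    · exact caseB h hu e (by linarith) hB
    push Not at hA hB
    exact (caseC h m0 (fun x hx => (hM1 x (by linarith)).le) (fun x hx => (hM2 x (by linarith)).le)
      rfl hu e hA hB).elim
  have l1 := lim_bot h hu e
  have l2 := lim_top h hu e
  exact ⟨u, T u, u_cont h hu e, v_cont h hu, hu.2, (hu.T h).2, rfl, hfix.symm,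
    l1.1, l2.2.1, l2.1, l1.2.1⟩
end

end IDE

open MeasureTheory Filter Real

/-- Existence of a spatially inhomogeneous 2-cycle of the integrodifference
equation with Laplace kernel and logistic growth, `ρ = 2.2`, any `σ > 0`. -/
theorem stmt0 (σ : ℝ) (hσ : 0 < σ) :
    let ρ : ℝ := 2.2
    let K : ℝ → ℝ := fun u => σ / 2 * Real.exp (-σ * |u|)
    let F : ℝ → ℝ := fun u => (1 + ρ) * u - ρ * u ^ 2
    let Q : (ℝ → ℝ) → (ℝ → ℝ) := fun N x => ∫ y : ℝ, K (x - y) * F (N y)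
    let nm : ℝ := (ρ + 2 - Real.sqrt (ρ ^ 2 - 4)) / (2 * ρ)
    let np : ℝ := (ρ + 2 + Real.sqrt (ρ ^ 2 - 4)) / (2 * ρ)
    nm < np ∧ F np = nm ∧ F nm = np ∧
    ∃ N₀ N₁ : ℝ → ℝ,
      Continuous N₀ ∧ Continuous N₁ ∧
      (∃ C : ℝ, ∀ x, |N₀ x| ≤ C) ∧ (∃ C : ℝ, ∀ x, |N₁ x| ≤ C) ∧
      N₁ = Q N₀ ∧ N₀ = Q N₁ ∧ N₀ ≠ N₁ ∧
      Tendsto N₀ atBot (nhds nm) ∧ Tendsto N₁ atTop (nhds nm) ∧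
      Tendsto N₀ atTop (nhds np) ∧ Tendsto N₁ atBot (nhds np) := by
  intro ρ K F Q nm np
  have hs : Real.sqrt (ρ ^ 2 - 4) ^ 2 = 21 / 25 := by
    rw [Real.sq_sqrt] <;> norm_num [ρ]
  have hs0 : 0 < Real.sqrt (ρ ^ 2 - 4) := Real.sqrt_pos.2 (by norm_num [ρ])
  have hnm : nm = (21 / 5 - Real.sqrt (ρ ^ 2 - 4)) * (5 / 22) := by
    simp only [nm, ρ]; ring
  have hnp : np = (21 / 5 + Real.sqrt (ρ ^ 2 - 4)) * (5 / 22) := by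
    simp only [np, ρ]; ring
  have hF : F = IDE.Fn := by
    funext x; simp only [F, ρ, IDE.Fn]; ring
  have h : IDE.Par nm np := by
    refine ⟨?_, ?_, ?_⟩
    · rw [hnm, hnp]; ring
    · rw [hnm, hnp]; linear_combination (-25 / 484) * hs
    · rw [hnm, hnp]
      have : ∀ s : ℝ, 0 < s → (21 / 5 - s) * (5 / 22) < (21 / 5 + s) * (5 / 22) := by
        intro s hs; linarith
      exact this _ hs0
  refine ⟨h.lt, by rw [hF]; exact h.Fb, by rw [hF]; exact h.Fa, ?_⟩
  obtain ⟨u, v, cu, cv, mu, mv, e1, e2, l1, l2, l3, l4⟩ := IDE.main h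
  have hQ : ∀ f : ℝ → ℝ, Continuous f → (∀ x, f x ∈ Set.Icc nm np) →
      Q (fun x => f (σ * x)) = fun x => IDE.T f (σ * x) := by
    intro f hf hm
    funext x
    change _ = IDE.LL _ _
    rw [← IDE.LL_eq (IDE.good_of h hf.measurable hm)]
    have := Measure.integral_comp_mul_left
      (fun y => (1 / 2 * exp (-|σ * x - y|)) * IDE.Fn (f y)) σ
    rw [abs_of_pos (inv_pos.2 hσ), smul_eq_mul, eq_inv_mul_iff_mul_eq₀ hσ.ne',
      ← integral_const_mul] at this
    rw [← this]
    change ∫ y : ℝ, K (x - y) * F (f (σ * y)) = _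
    rw [hF]
    congr 1
    funext y
    simp only [K]
    rw [← mul_sub, abs_mul, abs_of_pos hσ]
    ring_nf
  have hb : ∀ x ∈ Set.Icc nm np, |x| ≤ np := fun x hx => by
    rw [abs_of_nonneg (by linarith [hx.1, h.a1])]; exact hx.2
  have tt : Tendsto (fun x : ℝ => σ * x) atTop atTop := tendsto_id.const_mul_atTop hσ
  have tb : Tendsto (fun x : ℝ => σ * x) atBot atBot := tendsto_id.const_mul_atBot hσ
  refine ⟨fun x => u (σ * x), fun x => v (σ * x), by fun_prop, by fun_prop,
    ⟨np, fun x => hb _ (mu _)⟩, ⟨np, fun x => hb _ (mv _)⟩, ?_, ?_, ?_,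
    l1.comp tb, l2.comp tt, l3.comp tt, l4.comp tb⟩
  · rw [hQ u cu mu, ← e1]
  · rw [hQ v cv mv, ← e2]
  · intro heq
    have h1 := l1.comp tb
    have h2 : Tendsto (fun x => v (σ * x)) atBot (nhds np) := l4.comp tb
    rw [← heq] at h2
    exact h.lt.ne (tendsto_nhds_unique h1 h2)
end

section
/- Let σ > 0, let F : ℝ → ℝ be continuous, and let N, M : ℝ → ℝ be bounded continuous functions. If N = Q[M] and M = Q[N], where Q[N](x) = ∫_ℝ (σ/2)e^{−σ|x−y|} F(N(y)) dy, then N and M are twice continuously differentiable and satisfy N''(x) = σ²(N(x) − F(M(x))) and M''(x) = σ²(M(x) − F(N(x))) for all x ∈ ℝ. -/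
open MeasureTheory

theorem helper_aux (σ : ℝ) (hσ : 0 < σ) (g P : ℝ → ℝ) (hg : Continuous g)
    (hb : ∃ C : ℝ, ∀ x, |g x| ≤ C)
    (hP : ∀ x : ℝ, P x = ∫ y : ℝ, σ / 2 * Real.exp (-σ * |x - y|) * g y) :
    ContDiff ℝ 2 P ∧ ∀ x : ℝ, deriv (deriv P) x = σ ^ 2 * (P x - g x) := by
  obtain ⟨C, hC⟩ := hb
  have hIA : ∀ x, IntegrableOn (fun y => Real.exp (σ * y) * g y) (Set.Iic x) := fun x =>
    (integrableOn_exp_mul_Iic hσ x).mul_bdd (c := C) hg.aestronglyMeasurable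
      (Filter.Eventually.of_forall hC)
  have hIB : ∀ x, IntegrableOn (fun y => Real.exp (-σ * y) * g y) (Set.Ioi x) := fun x =>
    (integrableOn_exp_mul_Ioi (neg_lt_zero.2 hσ) x).mul_bdd (c := C) hg.aestronglyMeasurable
      (Filter.Eventually.of_forall hC)
  have hcA : Continuous (fun y => Real.exp (σ * y) * g y) := by fun_prop
  have hcB : Continuous (fun y => Real.exp (-σ * y) * g y) := by fun_prop
  let A : ℝ → ℝ := fun x => ∫ y in Set.Iic x, Real.exp (σ * y) * g y
  let B : ℝ → ℝ := fun x => ∫ y in Set.Ioi x, Real.exp (-σ * y) * g y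
  have hA : ∀ x, HasDerivAt A (Real.exp (σ * x) * g x) x := by
    intro x
    have h : A = fun x => A 0 + ∫ y in (0:ℝ)..x, Real.exp (σ * y) * g y := by
      funext x
      rw [← intervalIntegral.integral_Iic_sub_Iic (hIA 0) (hIA x)]
      simp only [A]; ring
    rw [h]
    exact (hcA.integral_hasStrictDerivAt 0 x).hasDerivAt.const_add _
  have hB : ∀ x, HasDerivAt B (-(Real.exp (-σ * x) * g x)) x := by
    intro x
    have h : B = fun x => B 0 - ∫ y in (0:ℝ)..x, Real.exp (-σ * y) * g y := by
      funext x
      have := intervalIntegral.integral_interval_add_Ioi (hIB 0) (hIB x)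
      simp only [B]; linarith
    rw [h]
    exact (hcB.integral_hasStrictDerivAt 0 x).hasDerivAt.const_sub _
  have hPeq : P = fun x => σ / 2 * (Real.exp (-σ * x) * A x + Real.exp (σ * x) * B x) := by
    funext x
    have e1 : Set.EqOn (fun y => σ / 2 * Real.exp (-σ * |x - y|) * g y)
        (fun y => (σ / 2 * Real.exp (-σ * x)) * (Real.exp (σ * y) * g y)) (Set.Iic x) := by
      intro y hy
      have : -σ * |x - y| = -σ * x + σ * y := by
        rw [abs_of_nonneg (sub_nonneg.2 hy)]; ring
      simp only [this, Real.exp_add]; ring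
    have e2 : Set.EqOn (fun y => σ / 2 * Real.exp (-σ * |x - y|) * g y)
        (fun y => (σ / 2 * Real.exp (σ * x)) * (Real.exp (-σ * y) * g y)) (Set.Ioi x) := by
      intro y hy
      have : -σ * |x - y| = σ * x + -σ * y := by
        rw [abs_of_nonpos (sub_nonpos.2 (le_of_lt hy))]; ring
      simp only [this, Real.exp_add]; ring
    rw [hP, ← intervalIntegral.integral_Iic_add_Ioi (b := x)
      (IntegrableOn.congr_fun ((hIA x).const_mul _) e1.symm measurableSet_Iic)
      (IntegrableOn.congr_fun ((hIB x).const_mul _) e2.symm measurableSet_Ioi),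
      setIntegral_congr_fun measurableSet_Iic e1, setIntegral_congr_fun measurableSet_Ioi e2,
      integral_const_mul, integral_const_mul]
    simp only [A, B]; ring
  have hE : ∀ c x : ℝ, HasDerivAt (fun x => Real.exp (c * x)) (c * Real.exp (c * x)) x := by
    intro c x
    have := ((hasDerivAt_id x).const_mul c).exp
    simpa [mul_comm] using this
  have hone : ∀ x, Real.exp (-σ * x) * Real.exp (σ * x) = 1 := by
    intro x; rw [← Real.exp_add]; simp
  have hd1 : ∀ x, HasDerivAt P
      (σ ^ 2 / 2 * (-(Real.exp (-σ * x) * A x) + Real.exp (σ * x) * B x)) x := by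
    intro x
    rw [hPeq]
    refine ((((hE (-σ) x).mul (hA x)).add ((hE σ x).mul (hB x))).const_mul (σ / 2)).congr_deriv ?_
    ring
  have hdP : deriv P = fun x =>
      σ ^ 2 / 2 * (-(Real.exp (-σ * x) * A x) + Real.exp (σ * x) * B x) :=
    funext fun x => (hd1 x).deriv
  have hd2 : ∀ x, HasDerivAt (deriv P) (σ ^ 2 * (P x - g x)) x := by
    intro x
    rw [hdP]
    refine ((((hE (-σ) x).mul (hA x)).neg.add
      ((hE σ x).mul (hB x))).const_mul (σ ^ 2 / 2)).congr_deriv ?_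
    rw [hPeq]
    linear_combination (-σ ^ 2 * g x) * hone x
  have hddP : deriv (deriv P) = fun x => σ ^ 2 * (P x - g x) := funext fun x => (hd2 x).deriv
  have hPd : Differentiable ℝ P := fun x => (hd1 x).differentiableAt
  refine ⟨?_, fun x => (hd2 x).deriv⟩
  have h1 : ContDiff ℝ 1 (deriv P) := by
    rw [contDiff_one_iff_deriv]
    refine ⟨fun x => (hd2 x).differentiableAt, ?_⟩
    rw [hddP]
    have := hPd.continuous
    fun_prop
  have : ContDiff ℝ (1 + 1) P :=
    contDiff_succ_iff_deriv.2 ⟨hPd, by simp, h1⟩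
  rwa [one_add_one_eq_two] at this

theorem helper_bdd (F N : ℝ → ℝ) (hF : Continuous F) (hNb : ∃ C : ℝ, ∀ x, |N x| ≤ C) :
    ∃ C : ℝ, ∀ x, |F (N x)| ≤ C := by
  obtain ⟨C, hC⟩ := hNb
  obtain ⟨D, hD⟩ := (isCompact_Icc (a := -C) (b := C)).exists_bound_of_continuousOn
    hF.continuousOn
  exact ⟨D, fun x => hD _ (abs_le.1 (hC x))⟩


/-- If bounded continuous `N, M` satisfy `N = Q[M]` and `M = Q[N]` for the
integrodifference operator with Laplace kernel, then they are twice continuously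
differentiable and satisfy the second-order ODE system. -/
theorem stmt1 (σ : ℝ) (hσ : 0 < σ) (F : ℝ → ℝ) (hF : Continuous F)
    (N M : ℝ → ℝ) (hNc : Continuous N) (hMc : Continuous M)
    (hNb : ∃ C : ℝ, ∀ x, |N x| ≤ C) (hMb : ∃ C : ℝ, ∀ x, |M x| ≤ C)
    (hN : ∀ x : ℝ, N x = ∫ y : ℝ, σ / 2 * Real.exp (-σ * |x - y|) * F (M y))
    (hM : ∀ x : ℝ, M x = ∫ y : ℝ, σ / 2 * Real.exp (-σ * |x - y|) * F (N y)) :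
    ContDiff ℝ 2 N ∧ ContDiff ℝ 2 M ∧
    (∀ x : ℝ, deriv (deriv N) x = σ ^ 2 * (N x - F (M x))) ∧
    (∀ x : ℝ, deriv (deriv M) x = σ ^ 2 * (M x - F (N x))) := by
  have h1 := helper_aux σ hσ (fun y => F (M y)) N (hF.comp hMc) (helper_bdd F M hF hMb) hN
  have h2 := helper_aux σ hσ (fun y => F (N y)) M (hF.comp hNc) (helper_bdd F N hF hNb) hM
  exact ⟨h1.1, h2.1, h1.2, h2.2⟩
end

section
/- Let σ > 0 and let F : ℝ → ℝ be continuous with F(n_+) = n_− and F(n_−) = n_+ for real numbers n_− < n_+. Suppose (N, u, M, v) : ℝ → ℝ⁴ is a differentiable solution of the first-order system N' = u, u' = σ²(N − F(M)), M' = v, v' = σ²(M − F(N)), and suppose lim_{t→±∞} u(t) = 0, lim_{t→±∞} v(t) = 0, lim_{t→±∞} N(t) = n_±, and lim_{t→±∞} M(t) = n_∓. Then N and M satisfy: lim_{x→±∞} N(x) = n_±, lim_{x→±∞} M(x) = n_∓, N = Q[M], and M = Q[N], where Q[N](x) = ∫_ℝ (σ/2)e^{−σ|x−y|} F(N(y))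 dy; i.e., (N, M) is a 2-cycle of the integrodifference equation. -/
open MeasureTheory Filter

lemma bounded_of_tendsto_aux (g : ℝ → ℝ) (hg : Continuous g) (a b : ℝ)
    (hT : Tendsto g atTop (nhds a)) (hB : Tendsto g atBot (nhds b)) :
    ∃ C, ∀ y, ‖g y‖ ≤ C := by
  have h1 : ∀ᶠ y in atTop, ‖g y‖ < ‖a‖ + 1 := hT.norm.eventually_lt_const (by linarith)
  have h2 : ∀ᶠ y in atBot, ‖g y‖ < ‖b‖ + 1 := hB.norm.eventually_lt_const (by linarith)
  obtain ⟨A, hA⟩ := eventually_atTop.1 h1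
  obtain ⟨B, hB⟩ := eventually_atBot.1 h2
  obtain ⟨C, hC⟩ := (isCompact_Icc (a := B) (b := A)).exists_bound_of_continuousOn hg.continuousOn
  refine ⟨max C (max (‖a‖ + 1) (‖b‖ + 1)), fun y => ?_⟩
  by_cases hy : A ≤ y
  · exact (hA y hy).le.trans (by simp)
  by_cases hy' : y ≤ B
  · exact (hB y hy').le.trans (by simp)
  · exact (hC y ⟨by linarith, by linarith⟩).trans (by simp)

lemma green_aux (σ : ℝ) (hσ : 0 < σ) (g N u : ℝ → ℝ) (hg : Continuous g) (a b c d : ℝ)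
    (hgT : Tendsto g atTop (nhds a)) (hgB : Tendsto g atBot (nhds b))
    (hN : ∀ t : ℝ, HasDerivAt N (u t) t)
    (hu : ∀ t : ℝ, HasDerivAt u (σ ^ 2 * (N t - g t)) t)
    (huTop : Tendsto u atTop (nhds 0)) (huBot : Tendsto u atBot (nhds 0))
    (hNTop : Tendsto N atTop (nhds c)) (hNBot : Tendsto N atBot (nhds d)) (x : ℝ) :
    N x = ∫ y : ℝ, σ / 2 * Real.exp (-σ * |x - y|) * g y := by
  obtain ⟨C, hC⟩ := bounded_of_tendsto_aux g hg a b hgT hgB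
  have eR : ∀ y ∈ Set.Ioi x, σ / 2 * Real.exp (σ * x) * Real.exp (-σ * y) * g y
      = σ / 2 * Real.exp (-σ * |x - y|) * g y := by
    intro y hy
    rw [abs_of_neg (sub_neg.2 hy), mul_assoc (σ / 2), ← Real.exp_add]
    ring_nf
  have eL : ∀ y ∈ Set.Iic x, σ / 2 * Real.exp (-σ * x) * Real.exp (σ * y) * g y
      = σ / 2 * Real.exp (-σ * |x - y|) * g y := by
    intro y hy
    rw [abs_of_nonneg (sub_nonneg.2 hy), mul_assoc (σ / 2), ← Real.exp_add]
    ring_nf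
  have iR : IntegrableOn (fun y => σ / 2 * Real.exp (σ * x) * Real.exp (-σ * y) * g y)
      (Set.Ioi x) :=
    ((integrableOn_exp_mul_Ioi (neg_lt_zero.2 hσ) x).const_mul _).mul_bdd
      hg.aestronglyMeasurable (Eventually.of_forall hC)
  have iL : IntegrableOn (fun y => σ / 2 * Real.exp (-σ * x) * Real.exp (σ * y) * g y)
      (Set.Iic x) :=
    ((integrableOn_exp_mul_Iic hσ x).const_mul _).mul_bdd
      hg.aestronglyMeasurable (Eventually.of_forall hC)
  have hexp : ∀ k y : ℝ, HasDerivAt (fun y => Real.exp (k * y)) (Real.exp (k * y) * k) y := by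
    intro k y
    simpa using ((hasDerivAt_id y).const_mul k).exp
  have R := integral_Ioi_of_hasDerivAt_of_tendsto' (a := x) (m := 0)
    (f := fun y => -(1 / (2 * σ)) * Real.exp (σ * x) * (Real.exp (-σ * y) * (u y + σ * N y)))
    (fun y _ => by
      refine (((hexp (-σ) y).mul ((hu y).add ((hN y).const_mul σ))).const_mul
        (-(1 / (2 * σ)) * Real.exp (σ * x))).congr_deriv ?_
      simp only [Pi.add_apply]
      field_simp
      ring) iR (by
      have h1 : Tendsto (fun y : ℝ => Real.exp (-σ * y)) atTop (nhds 0) :=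
        Real.tendsto_exp_atBot.comp (tendsto_id.const_mul_atTop_of_neg (neg_lt_zero.2 hσ))
      simpa using (h1.mul (huTop.add (hNTop.const_mul σ))).const_mul
        (-(1 / (2 * σ)) * Real.exp (σ * x)))
  have L := integral_Iic_of_hasDerivAt_of_tendsto' (a := x) (m := 0)
    (f := fun y => (1 / (2 * σ)) * Real.exp (-σ * x) * (Real.exp (σ * y) * (σ * N y - u y)))
    (fun y _ => by
      refine (((hexp σ y).mul (((hN y).const_mul σ).sub (hu y))).const_mul
        ((1 / (2 * σ)) * Real.exp (-σ * x))).congr_deriv ?_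
      simp only [Pi.sub_apply]
      field_simp
      ring) iL (by
      have h1 : Tendsto (fun y : ℝ => Real.exp (σ * y)) atBot (nhds 0) :=
        Real.tendsto_exp_atBot.comp (tendsto_id.const_mul_atBot hσ)
      simpa using (h1.mul ((hNBot.const_mul σ).sub huBot)).const_mul
        ((1 / (2 * σ)) * Real.exp (-σ * x)))
  rw [setIntegral_congr_fun measurableSet_Ioi eR] at R
  rw [setIntegral_congr_fun measurableSet_Iic eL] at L
  rw [← intervalIntegral.integral_Iic_add_Ioi
    (iL.congr_fun eL measurableSet_Iic) (iR.congr_fun eR measurableSet_Ioi), R, L]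
  have he : Real.exp (σ * x) * Real.exp (-σ * x) = 1 := by
    rw [← Real.exp_add]; simp
  have hs : σ * (1 / (2 * σ)) = 1 / 2 := by field_simp
  linear_combination (-2 * N x * σ * (1 / (2 * σ))) * he - 2 * N x * hs

/-- A solution of the four-dimensional first-order system with the prescribed limits
at `±∞` yields a 2-cycle of the integrodifference equation. -/
theorem stmt3 (σ : ℝ) (hσ : 0 < σ) (F : ℝ → ℝ) (hF : Continuous F)
    (nm np : ℝ) (hlt : nm < np) (hFp : F np = nm) (hFm : F nm = np)
    (N u M v : ℝ → ℝ)
    (hN : ∀ t : ℝ, HasDerivAt N (u t) t)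
    (hu : ∀ t : ℝ, HasDerivAt u (σ ^ 2 * (N t - F (M t))) t)
    (hM : ∀ t : ℝ, HasDerivAt M (v t) t)
    (hv : ∀ t : ℝ, HasDerivAt v (σ ^ 2 * (M t - F (N t))) t)
    (huTop : Tendsto u atTop (nhds 0)) (huBot : Tendsto u atBot (nhds 0))
    (hvTop : Tendsto v atTop (nhds 0)) (hvBot : Tendsto v atBot (nhds 0))
    (hNTop : Tendsto N atTop (nhds np)) (hNBot : Tendsto N atBot (nhds nm))
    (hMTop : Tendsto M atTop (nhds nm)) (hMBot : Tendsto M atBot (nhds np)) :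
    Tendsto N atTop (nhds np) ∧ Tendsto N atBot (nhds nm) ∧
    Tendsto M atTop (nhds nm) ∧ Tendsto M atBot (nhds np) ∧
    (∀ x : ℝ, N x = ∫ y : ℝ, σ / 2 * Real.exp (-σ * |x - y|) * F (M y)) ∧
    (∀ x : ℝ, M x = ∫ y : ℝ, σ / 2 * Real.exp (-σ * |x - y|) * F (N y)) := by
  exact ⟨hNTop, hNBot, hMTop, hMBot,
    green_aux σ hσ (fun t => F (M t)) N u
      (hF.comp (continuous_iff_continuousAt.2 fun t => (hM t).continuousAt)) _ _ _ _
      ((hF.tendsto nm).comp hMTop) ((hF.tendsto np).comp hMBot) hN hu huTop huBot hNTop hNBot,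
    green_aux σ hσ (fun t => F (N t)) M v
      (hF.comp (continuous_iff_continuousAt.2 fun t => (hN t).continuousAt)) _ _ _ _
      ((hF.tendsto np).comp hNTop) ((hF.tendsto nm).comp hNBot) hM hv hvTop hvBot hMTop hMBot⟩
end

section
/- Let ν ≥ 1 and let u, v : ℕ → ℝ be sequences with ‖u‖ = |u₀| + 2∑_{k≥1}|u_k|ν^k < ∞ and ‖v‖ = |v₀| + 2∑_{k≥1}|v_k|ν^k < ∞. Define the Chebyshev convolution (u*v)_n = ∑_{k∈ℤ} u_{|k|} v_{|n−k|} for n ∈ ℕ. Then each series defining (u*v)_n converges absolutely, and ‖u*v‖ ≤ ‖u‖·‖v‖; moreover the convolution is commutative. In particular, the space C_ν of such sequences with this norm and product is a commutative Banach algebra. -/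
theorem cheb_hasSum (ν : ℝ) (ω : ℕ → ℝ) (hω0 : ω 0 = 1)
    (hωk : ∀ k : ℕ, 0 < k → ω k = 2 * ν ^ k) (f : ℕ → ℝ) (s : ℝ)
    (h : HasSum (fun k => f k * ω k) s) :
    HasSum (fun k : ℤ => f k.natAbs * ν ^ k.natAbs) s := by
  have h1 : HasSum (fun n : ℕ => f (n + 1) * ω (n + 1)) (s - f 0) := by
    have := (hasSum_nat_add_iff' (f := fun k => f k * ω k) 1).2 h
    simpa [hω0] using this
  have h2 : HasSum (fun n : ℕ => f (n + 1) * ν ^ (n + 1)) ((s - f 0) / 2) := by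
    have := h1.div_const 2
    refine this.congr_fun ?_ |> fun h => h
    intro n
    rw [hωk (n + 1) n.succ_pos]; ring
  have h3 := HasSum.of_add_one_of_neg_add_one
    (f := fun k : ℤ => f k.natAbs * ν ^ k.natAbs) (m := (s - f 0) / 2) (m' := (s - f 0) / 2)
    (by
      have e : ∀ n : ℕ, ((n : ℤ) + 1).natAbs = n + 1 := fun n => by omega
      simpa only [e] using h2)
    (by
      have e : ∀ n : ℕ, (-((n : ℤ) + 1)).natAbs = n + 1 := fun n => by omega
      simpa only [e] using h2)
  convert h3 using 1
  simp
  ring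

theorem cheb_summable (ν : ℝ) (ω : ℕ → ℝ)
    (hωk : ∀ k : ℕ, 0 < k → ω k = 2 * ν ^ k) (f : ℕ → ℝ)
    (h : Summable (fun k : ℤ => f k.natAbs * ν ^ k.natAbs)) :
    Summable (fun k => f k * ω k) := by
  have h1 := h.comp_injective (i := fun n : ℕ => ((n + 1 : ℕ) : ℤ))
    (fun a b hab => by simpa using hab)
  rw [← summable_nat_add_iff 1]
  refine (h1.mul_left 2).congr fun n => ?_
  simp only [Function.comp, Int.natAbs_natCast]
  rw [hωk (n + 1) n.succ_pos]; ring

def chebEquiv : ℤ × ℤ ≃ ℤ × ℤ where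
  toFun p := (p.2, p.1 - p.2)
  invFun q := (q.1 + q.2, q.1)
  left_inv p := by ext <;> simp
  right_inv p := by ext <;> simp


/-- The weighted `ℓ¹` space of Chebyshev coefficients is a commutative Banach
algebra under the Chebyshev convolution: the defining series converge absolutely,
the convolution stays in the space with submultiplicative norm, and it is
commutative. -/
theorem stmt8 (ν : ℝ) (hν : 1 ≤ ν)
    (ω : ℕ → ℝ) (hω0 : ω 0 = 1) (hωk : ∀ k : ℕ, 0 < k → ω k = 2 * ν ^ k)
    (u v : ℕ → ℝ)
    (hu : Summable fun k => |u k| * ω k) (hv : Summable fun k => |v k| * ω k) :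
    let conv : (ℕ → ℝ) → (ℕ → ℝ) → ℕ → ℝ := fun a b n =>
      ∑' k : ℤ, a k.natAbs * b ((n : ℤ) - k).natAbs
    (∀ n : ℕ, Summable fun k : ℤ => |u k.natAbs * v ((n : ℤ) - k).natAbs|) ∧
    Summable (fun n => |conv u v n| * ω n) ∧
    (∑' n : ℕ, |conv u v n| * ω n) ≤
      (∑' k : ℕ, |u k| * ω k) * (∑' k : ℕ, |v k| * ω k) ∧
    conv u v = conv v u := by
  intro conv
  have hν0 : 0 ≤ ν := by linarith
  have hF := cheb_hasSum ν ω hω0 hωk (fun k => |u k|) _ hu.hasSum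
  have hG := cheb_hasSum ν ω hω0 hωk (fun k => |v k|) _ hv.hasSum
  set A := ∑' k, |u k| * ω k
  set B := ∑' k, |v k| * ω k
  set F : ℤ → ℝ := fun k => |u k.natAbs| * ν ^ k.natAbs with hFd
  set G : ℤ → ℝ := fun k => |v k.natAbs| * ν ^ k.natAbs with hGd
  have hF0 : ∀ k, 0 ≤ F k := fun k => by positivity
  have hG0 : ∀ k, 0 ≤ G k := fun k => by positivity
  have hFG : Summable (fun p : ℤ × ℤ => F p.1 * G p.2) :=
    hF.summable.mul_of_nonneg hG.summable hF0 hG0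
  have hFGs : HasSum (fun p : ℤ × ℤ => F p.1 * G p.2) (A * B) := hF.mul hG hFG
  have hH : HasSum (fun p : ℤ × ℤ => F p.2 * G (p.1 - p.2)) (A * B) :=
    (chebEquiv.hasSum_iff (f := fun p : ℤ × ℤ => F p.1 * G p.2)).2 hFGs
  have hHn : ∀ n : ℤ, Summable fun k : ℤ => F k * G (n - k) :=
    fun n => hH.summable.prod_factor n
  have hsum : HasSum (fun n : ℤ => ∑' k : ℤ, F k * G (n - k)) (A * B) :=
    hH.prod_fiberwise fun n => (hHn n).hasSum
  have hpt : ∀ n k : ℤ, |u k.natAbs * v (n - k).natAbs| * ν ^ n.natAbs ≤ F k * G (n - k) := by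
    intro n k
    have h1 : ν ^ n.natAbs ≤ ν ^ k.natAbs * ν ^ (n - k).natAbs := by
      rw [← pow_add]
      exact pow_le_pow_right₀ hν (by omega)
    calc _ ≤ |u k.natAbs * v (n - k).natAbs| * (ν ^ k.natAbs * ν ^ (n - k).natAbs) := by gcongr
      _ = _ := by rw [abs_mul]; simp only [hFd, hGd]; ring
  have habs : ∀ n : ℤ, Summable fun k : ℤ => |u k.natAbs * v (n - k).natAbs| := by
    intro n
    refine Summable.of_nonneg_of_le (fun k => abs_nonneg _) (fun k => ?_) (hHn n)
    refine le_trans ?_ (hpt n k)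
    exact le_mul_of_one_le_right (abs_nonneg _) (one_le_pow₀ hν)
  have hc : ∀ n : ℤ, conv u v n.natAbs = ∑' k : ℤ, u k.natAbs * v (n - k).natAbs := by
    intro n
    simp only [conv]
    rcases Int.natAbs_eq n with h | h
    · rw [← h]
    · rw [← (Equiv.neg ℤ).tsum_eq]
      refine tsum_congr fun k => ?_
      have e1 : ((Equiv.neg ℤ) k).natAbs = k.natAbs := by simp
      have e2 : ((n.natAbs : ℤ) - (Equiv.neg ℤ) k).natAbs = (n - k).natAbs := by
        simp only [Equiv.neg_apply]; omega
      rw [e1, e2]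
  have hle : ∀ n : ℤ, |conv u v n.natAbs| * ν ^ n.natAbs ≤ ∑' k : ℤ, F k * G (n - k) := by
    intro n
    rw [hc n]
    have h1 : |∑' k : ℤ, u k.natAbs * v (n - k).natAbs| ≤
        ∑' k : ℤ, |u k.natAbs * v (n - k).natAbs| := by
      simpa only [Real.norm_eq_abs] using
        norm_tsum_le_tsum_norm (f := fun k : ℤ => u k.natAbs * v (n - k).natAbs)
          (by simpa only [Real.norm_eq_abs] using habs n)
    calc _ ≤ (∑' k : ℤ, |u k.natAbs * v (n - k).natAbs|) * ν ^ n.natAbs := by gcongr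
      _ = ∑' k : ℤ, |u k.natAbs * v (n - k).natAbs| * ν ^ n.natAbs := tsum_mul_right.symm
      _ ≤ _ := ((habs n).mul_right _).tsum_le_tsum (hpt n) (hHn n)
  have hcs : Summable fun n : ℤ => |conv u v n.natAbs| * ν ^ n.natAbs :=
    Summable.of_nonneg_of_le (fun n => by positivity) hle hsum.summable
  have hS : Summable (fun n => |conv u v n| * ω n) :=
    cheb_summable ν ω hωk (fun n => |conv u v n|) hcs
  refine ⟨fun n => habs n, hS, ?_, ?_⟩
  · have hT := cheb_hasSum ν ω hω0 hωk (fun k => |conv u v k|) _ hS.hasSum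
    exact hasSum_le hle hT hsum
  · funext n
    simp only [conv]
    rw [← (Equiv.subLeft (n : ℤ)).tsum_eq]
    refine tsum_congr fun k => ?_
    simp only [Equiv.subLeft_apply, sub_sub_cancel]
    ring
end

section
/- Let N ∈ ℕ, ν ≥ 1, and let u, h : ℕ → ℝ with ‖h‖ = |h₀| + 2∑_{k≥1}|h_k|ν^k < ∞. Suppose u_k = 0 for all k > N, and let h^{(∞)} denote the tail of h, i.e., h^{(∞)}_k = 0 for 0 ≤ k ≤ N and h^{(∞)}_k = h_k for k > N. Then for every k with 0 ≤ k ≤ N + 1, the Chebyshev convolution satisfies |(u * h^{(∞)})_k| ≤ Ψ_k(u) · ‖h‖, where Ψ_k(u) = max_{j = N+1, …, k+N} |u_{|k+j|} + u_{|k−j|}| / (2ν^j), with the convention that the maximum over an empty range equals 0. -/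
/-- Tail estimate: for a sequence `u` supported on `{0,…,N}` and the tail `h⁽∞⁾` of
`h ∈ C_ν`, the Chebyshev convolution satisfies `|(u * h⁽∞⁾)_k| ≤ Ψ_k(u) ‖h‖` for
`0 ≤ k ≤ N+1`, where the max over an empty range is `0`. -/
theorem stmt12 (N : ℕ) (ν : ℝ) (hν : 1 ≤ ν) (u h : ℕ → ℝ)
    (hu : ∀ k : ℕ, k > N → u k = 0)
    (hh : Summable fun k : ℕ => |h k| * (if k = 0 then 1 else 2 * ν ^ k)) :
    let ω : ℕ → ℝ := fun k => if k = 0 then 1 else 2 * ν ^ k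
    let hT : ℕ → ℝ := fun k => if k ≤ N then 0 else h k
    let Ψ : ℕ → ℝ := fun k =>
      ⨆ j ∈ Finset.Icc (N + 1) (k + N),
        |u (k + j) + u ((k : ℤ) - (j : ℤ)).natAbs| / (2 * ν ^ j)
    ∀ k : ℕ, k ≤ N + 1 →
      |∑' j : ℤ, u j.natAbs * hT ((k : ℤ) - j).natAbs| ≤
        Ψ k * ∑' m : ℕ, |h m| * ω m := by
  intro ω hT Ψ k hk
  have hν0 : 0 < ν := by linarith
  have hnn : ∀ j : ℕ, 0 ≤ |u (k + j) + u ((k : ℤ) - (j : ℤ)).natAbs| / (2 * ν ^ j) := by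
    intro j; positivity
  have hΨ : ∀ j ∈ Finset.Icc (N + 1) (k + N),
      |u (k + j) + u ((k : ℤ) - (j : ℤ)).natAbs| / (2 * ν ^ j) ≤ Ψ k := by
    intro j hj
    have hb : BddAbove (Set.range fun j : ℕ => ⨆ (_ : j ∈ Finset.Icc (N + 1) (k + N)),
        |u (k + j) + u ((k : ℤ) - (j : ℤ)).natAbs| / (2 * ν ^ j)) := by
      refine ⟨∑ j ∈ Finset.Icc (N + 1) (k + N),
        |u (k + j) + u ((k : ℤ) - (j : ℤ)).natAbs| / (2 * ν ^ j), ?_⟩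
      rintro _ ⟨i, rfl⟩
      refine Real.iSup_le (fun hi => ?_) (Finset.sum_nonneg fun i _ => hnn i)
      exact Finset.single_le_sum
        (f := fun j : ℕ => |u (k + j) + u ((k : ℤ) - (j : ℤ)).natAbs| / (2 * ν ^ j))
        (fun i _ => hnn i) hi
    refine le_trans ?_ (le_ciSup hb j)
    haveI : Nonempty (j ∈ Finset.Icc (N + 1) (k + N)) := ⟨hj⟩
    simp only [ciSup_const, le_refl]
  have hΨ0 : 0 ≤ Ψ k :=
    Real.iSup_nonneg fun j => Real.iSup_nonneg fun _ => hnn j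
  have hsum : ∑' j : ℤ, u j.natAbs * hT ((k : ℤ) - j).natAbs =
      ∑ m ∈ Finset.Icc (N + 1) (k + N), u ((k : ℤ) - (m : ℤ)).natAbs * h m := by
    rw [← (Equiv.subLeft (k : ℤ)).tsum_eq]
    simp only [Equiv.subLeft_apply, sub_sub_cancel]
    rw [tsum_eq_sum (s := (Finset.Icc (N + 1) (k + N)).map Nat.castEmbedding)]
    · rw [Finset.sum_map]
      refine Finset.sum_congr rfl fun m hm => ?_
      rw [Finset.mem_Icc] at hm
      have h1 : ¬ m ≤ N := by omega
      simp [hT, h1]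
    · intro m hm
      by_cases h1 : m.natAbs ≤ N
      · simp [hT, h1]
      · have h2 : N < ((k : ℤ) - m).natAbs := by
          by_contra h3
          apply hm
          rw [Finset.mem_map]
          refine ⟨m.natAbs, ?_, ?_⟩
          · rw [Finset.mem_Icc]; omega
          · simp only [Nat.castEmbedding_apply]; omega
        rw [hu _ h2, zero_mul]
  rw [hsum]
  have hω : ∀ m, 0 ≤ |h m| * ω m := by
    intro m
    simp only [ω]
    split_ifs <;> positivity
  calc |∑ m ∈ Finset.Icc (N + 1) (k + N), u ((k : ℤ) - (m : ℤ)).natAbs * h m|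
      ≤ ∑ m ∈ Finset.Icc (N + 1) (k + N), |u ((k : ℤ) - (m : ℤ)).natAbs * h m| :=
        Finset.abs_sum_le_sum_abs _ _
    _ ≤ ∑ m ∈ Finset.Icc (N + 1) (k + N), Ψ k * (|h m| * ω m) := by
        refine Finset.sum_le_sum fun m hm => ?_
        have h1 := hΨ m hm
        rw [Finset.mem_Icc] at hm
        rw [hu (k + m) (by omega), zero_add, div_le_iff₀ (by positivity)] at h1
        have h2 : ω m = 2 * ν ^ m := by
          simp only [ω]; rw [if_neg (by omega)]
        rw [abs_mul, h2]
        calc _ ≤ (Ψ k * (2 * ν ^ m)) * |h m| := mul_le_mul_of_nonneg_right h1 (abs_nonneg _)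
          _ = _ := by ring
    _ = Ψ k * ∑ m ∈ Finset.Icc (N + 1) (k + N), |h m| * ω m := by rw [Finset.mul_sum]
    _ ≤ _ := mul_le_mul_of_nonneg_left (hh.sum_le_tsum _ fun m _ => hω m) hΨ0
end

section
/- Let ν ≥ 1 and set ω₀ = 1, ω_k = 2ν^k for k ≥ 1. Define the linear operator Υ on the weighted ℓ¹ space C_ν = {h : ℕ → ℝ : ‖h‖ = ∑_{k≥0}|h_k|ω_k < ∞} by (Υh)₀ = 0 and (Υh)_k = h_{k−1} − h_{k+1} for k ≥ 1. Then Υ is a bounded linear operator from C_ν to C_ν and its operator norm equals 2ν. -/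
/-- The operator `Υ`, `(Υh)₀ = 0`, `(Υh)_k = h_{k−1} − h_{k+1}` for `k ≥ 1`, is a
bounded linear operator on the weighted `ℓ¹` space `C_ν` with operator norm `2ν`. -/
theorem stmt13 (ν : ℝ) (hν : 1 ≤ ν) :
    let ω : ℕ → ℝ := fun k => if k = 0 then 1 else 2 * ν ^ k
    let Υ : (ℕ → ℝ) → ℕ → ℝ := fun h k => if k = 0 then 0 else h (k - 1) - h (k + 1)
    (∀ h : ℕ → ℝ, Summable (fun k => |h k| * ω k) →
      Summable (fun k => |Υ h k| * ω k) ∧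
      (∑' k : ℕ, |Υ h k| * ω k) ≤ 2 * ν * ∑' k : ℕ, |h k| * ω k) ∧
    (∀ C : ℝ, (∀ h : ℕ → ℝ, Summable (fun k => |h k| * ω k) →
        (∑' k : ℕ, |Υ h k| * ω k) ≤ C * ∑' k : ℕ, |h k| * ω k) → 2 * ν ≤ C) := by
  intro ω Υ
  have hν0 : 0 < ν := by linarith
  have hωpos : ∀ k, 0 ≤ ω k := by
    intro k
    simp only [ω]
    split_ifs <;> positivity
  constructor
  · intro h hs
    set a : ℕ → ℝ := fun k => |h k| * ω k with ha
    have ha0 : ∀ k, 0 ≤ a k := fun k => mul_nonneg (abs_nonneg _) (hωpos k)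
    have hs2 : Summable (fun k => a (k + 2)) := (summable_nat_add_iff 2).2 hs
    have hsum : HasSum (fun k => ν * a k + (if k = 0 then ν * a 0 else 0) + ν * a (k + 2))
        (ν * (∑' k, a k) + ν * a 0 + ν * (∑' k, a (k + 2))) := by
      refine ((hs.hasSum.mul_left ν).add ?_).add (hs2.hasSum.mul_left ν)
      exact hasSum_ite_eq 0 (ν * a 0)
    have hbound : ∀ k, |Υ h (k + 1)| * ω (k + 1) ≤
        ν * a k + (if k = 0 then ν * a 0 else 0) + ν * a (k + 2) := by
      intro k
      have h1 : |Υ h (k + 1)| ≤ |h k| + |h (k + 2)| := by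
        simpa [Υ] using abs_sub (h k) (h (k + 2))
      have h2 : |h k| * ω (k + 1) = ν * a k + (if k = 0 then ν * a 0 else 0) := by
        by_cases hk : k = 0
        · subst hk
          simp [a, ω]
          ring
        · simp [a, ω, hk]
          ring
      have h3 : ω (k + 1) ≤ ν * ω (k + 2) := by
        simp only [ω, Nat.add_eq_zero_iff, OfNat.ofNat_ne_zero, one_ne_zero, and_false, if_false]
        have : 0 ≤ ν ^ (k + 1) := by positivity
        rw [pow_succ ν (k + 1)]
        have hn : 1 ≤ ν * ν := by nlinarith
        nlinarith
      have h4 : |h (k + 2)| * ω (k + 1) ≤ ν * a (k + 2) := by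
        have := mul_le_mul_of_nonneg_left h3 (abs_nonneg (h (k + 2)))
        simp only [a]
        linarith
      have h5 := mul_le_mul_of_nonneg_right h1 (hωpos (k + 1))
      linarith
    have hS1 : Summable (fun k => |Υ h (k + 1)| * ω (k + 1)) :=
      Summable.of_nonneg_of_le (fun k => mul_nonneg (abs_nonneg _) (hωpos _)) hbound hsum.summable
    have hS : Summable (fun k => |Υ h k| * ω k) := (summable_nat_add_iff 1).1 hS1
    refine ⟨hS, ?_⟩
    rw [hS.tsum_eq_zero_add]
    have h0 : |Υ h 0| * ω 0 = 0 := by simp [Υ]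
    rw [h0, zero_add]
    have hle := hS1.tsum_le_tsum hbound hsum.summable
    rw [hsum.tsum_eq] at hle
    have hsplit := hs.sum_add_tsum_nat_add 2
    simp only [Finset.sum_range_succ, Finset.sum_range_zero, zero_add] at hsplit
    have e : ∑' k, a (k + 2) = (∑' k, a k) - a 0 - a 1 := by linarith
    rw [e] at hle
    have := mul_nonneg hν0.le (ha0 1)
    linarith
  · intro C hC
    have hA : HasSum (fun k => |(Pi.single 0 1 : ℕ → ℝ) k| * ω k) 1 := by
      convert hasSum_ite_eq (0 : ℕ) (1 : ℝ) using 2 with k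
      by_cases hk : k = 0
      · subst hk
        simp [ω]
      · simp [hk]
    have hB : HasSum (fun k => |Υ (Pi.single 0 1 : ℕ → ℝ) k| * ω k) (2 * ν) := by
      convert hasSum_ite_eq (1 : ℕ) (2 * ν) using 2 with k
      match k with
      | 0 => simp [Υ]
      | 1 => simp [Υ, ω]
      | k + 2 => simp [Υ]
    have := hC _ hA.summable
    rw [hA.tsum_eq, hB.tsum_eq] at this
    linarith
end

section
/- Let n, d ≥ 1, let f : ℝⁿ → ℝⁿ be continuously differentiable, let x̃ ∈ ℝⁿ, and let Λ be a d×d real diagonal matrix with diagonal entries λ₁, …, λ_d all strictly negative. Let B ⊆ ℝ^d be the closed unit ball centered at 0, and let P : ℝ^d → ℝⁿ be continuously differentiable with P(0) = x̃ and satisfying the invariance (conjugacy) PDE DP(θ)[Λθ] = f(P(θ)) for all θ ∈ B. Then f(x̃) = 0, and for every θ ∈ B the curve ζ(t) = P(e^{Λt}θ) is defined for all t ≥ 0 (since e^{Λt}θ ∈ B for t ≥ 0), satisfies ζ(0) = P(θ) and ζ'(t) = f(ζ(t)) for all t ≥ 0, and converges: lim_{t→∞} ζ(t) = x̃. In particular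 P(B) is contained in the stable set of the equilibrium x̃. -/
open Filter

/-- Parameterization method: a `C¹` map `P` on the closed unit ball with `P 0 = xt`
solving the invariance equation `DP(θ)[Λθ] = f(P(θ))` (with `Λ` diagonal, all
diagonal entries negative) parameterizes part of the stable set of the equilibrium
`xt`: `f xt = 0`, the curves `ζ(t) = P(e^{Λt}θ)` stay defined for `t ≥ 0`, solve
`ζ' = f(ζ)` and converge to `xt`. -/
theorem stmt16 (n d : ℕ) (hn : 1 ≤ n) (hd : 1 ≤ d)
    (f : (Fin n → ℝ) → (Fin n → ℝ)) (hf : ContDiff ℝ 1 f)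
    (xt : Fin n → ℝ) (l : Fin d → ℝ) (hl : ∀ i, l i < 0)
    (P : (Fin d → ℝ) → (Fin n → ℝ)) (hP : ContDiff ℝ 1 P) (hP0 : P 0 = xt)
    (hinv : ∀ θ ∈ Metric.closedBall (0 : Fin d → ℝ) 1,
      fderiv ℝ P θ (fun i => l i * θ i) = f (P θ)) :
    f xt = 0 ∧
    ∀ θ ∈ Metric.closedBall (0 : Fin d → ℝ) 1,
      (∀ t : ℝ, 0 ≤ t →
        (fun i => Real.exp (l i * t) * θ i) ∈ Metric.closedBall (0 : Fin d → ℝ) 1) ∧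
      P (fun i => Real.exp (l i * 0) * θ i) = P θ ∧
      (∀ t : ℝ, 0 ≤ t →
        HasDerivAt (fun s : ℝ => P (fun i => Real.exp (l i * s) * θ i))
          (f (P (fun i => Real.exp (l i * t) * θ i))) t) ∧
      Tendsto (fun t : ℝ => P (fun i => Real.exp (l i * t) * θ i)) atTop (nhds xt) := by
  have hball : ∀ θ ∈ Metric.closedBall (0 : Fin d → ℝ) 1, ∀ t : ℝ, 0 ≤ t →
      (fun i => Real.exp (l i * t) * θ i) ∈ Metric.closedBall (0 : Fin d → ℝ) 1 := by
    intro θ hθ t ht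
    rw [mem_closedBall_zero_iff] at hθ ⊢
    rw [pi_norm_le_iff_of_nonneg zero_le_one] at hθ ⊢
    intro i
    rw [norm_mul, Real.norm_eq_abs, Real.abs_exp]
    have h1 : Real.exp (l i * t) ≤ 1 :=
      Real.exp_le_one_iff.mpr (mul_nonpos_of_nonpos_of_nonneg (hl i).le ht)
    exact mul_le_one₀ h1 (norm_nonneg _) (hθ i)
  refine ⟨?_, fun θ hθ => ⟨hball θ hθ, by simp, ?_, ?_⟩⟩
  · have h := hinv 0 (by simp)
    rw [hP0] at h
    rw [← h]
    have h0 : (fun i => l i * (0 : Fin d → ℝ) i) = 0 := by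
      ext i
      simp
    rw [h0, map_zero]
  · intro t ht
    rw [← hinv _ (hball θ hθ t ht)]
    have hc : HasDerivAt (fun s : ℝ => (fun i => Real.exp (l i * s) * θ i))
        (fun i => l i * (Real.exp (l i * t) * θ i)) t := by
      rw [hasDerivAt_pi]
      intro i
      have h1 : HasDerivAt (fun s : ℝ => l i * s) (l i) t := by
        simpa using (hasDerivAt_id t).const_mul (l i)
      have h2 := (h1.exp).mul_const (θ i)
      have h3 : l i * (Real.exp (l i * t) * θ i) = Real.exp (l i * t) * l i * θ i := by ring
      change HasDerivAt (fun s : ℝ => Real.exp (l i * s) * θ i)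
        (l i * (Real.exp (l i * t) * θ i)) t
      rw [h3]
      exact h2
    have hd' := (hP.differentiable one_ne_zero
      (fun i => Real.exp (l i * t) * θ i)).hasFDerivAt
    exact hd'.comp_hasDerivAt t hc
  · rw [← hP0]
    refine (hP.continuous.tendsto 0).comp ?_
    rw [tendsto_pi_nhds]
    intro i
    have h1 : Tendsto (fun t : ℝ => l i * t) atTop atBot :=
      tendsto_id.const_mul_atTop_of_neg (hl i)
    simpa using (Real.tendsto_exp_atBot.comp h1).mul_const (θ i)
end

section
/- (Newton–Kantorovich / radii polynomial theorem) Let X and Y be Banach spaces and G : X → Y a Fréchet differentiable map. Let x̄ ∈ X, let A† : X → Y be a bounded linear map, and let A : Y → X be a bounded linear injective map. Suppose there are constants Y₀, Z₀, Z₁ ≥ 0 and a function Z₂ : (0, ∞) → [0, ∞) such that: ‖A G(x̄)‖_X ≤ Y₀; ‖I − A A†‖_{B(X)} ≤ Z₀; ‖A (DG(x̄) − A†)‖_{B(X)} ≤ Z₁; and for all r > 0 and all c in the closed ball of radius r centered at x̄, ‖A (DG(c) − DG(x̄))‖_{B(X)} ≤ Z₂(r)·r. If there exists r₀ > 0 such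 that Z₂(r₀)·r₀² − (1 − Z₀ − Z₁)·r₀ + Y₀ < 0, then there exists a unique x̃ in the closed ball of radius r₀ centered at x̄ with G(x̃) = 0. -/
/-- Newton–Kantorovich / radii polynomial theorem: if the radii polynomial
`Z₂(r₀)r₀² − (1 − Z₀ − Z₁)r₀ + Y₀` is negative for some `r₀ > 0`, then `G` has a
unique zero in the closed ball of radius `r₀` around the approximate solution. -/
theorem stmt17 {X Y : Type*}
    [NormedAddCommGroup X] [NormedSpace ℝ X] [CompleteSpace X]
    [NormedAddCommGroup Y] [NormedSpace ℝ Y] [CompleteSpace Y]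
    (G : X → Y) (hG : Differentiable ℝ G)
    (x₀ : X) (A' : X →L[ℝ] Y) (A : Y →L[ℝ] X) (hA : Function.Injective A)
    (Y₀ Z₀ Z₁ : ℝ) (Z₂ : ℝ → ℝ)
    (hY₀ : 0 ≤ Y₀) (hZ₀ : 0 ≤ Z₀) (hZ₁ : 0 ≤ Z₁) (hZ₂ : ∀ r, 0 < r → 0 ≤ Z₂ r)
    (h1 : ‖A (G x₀)‖ ≤ Y₀)
    (h2 : ‖ContinuousLinearMap.id ℝ X - A.comp A'‖ ≤ Z₀)
    (h3 : ‖A.comp (fderiv ℝ G x₀ - A')‖ ≤ Z₁)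
    (h4 : ∀ r : ℝ, 0 < r → ∀ c ∈ Metric.closedBall x₀ r,
      ‖A.comp (fderiv ℝ G c - fderiv ℝ G x₀)‖ ≤ Z₂ r * r)
    (r₀ : ℝ) (hr₀ : 0 < r₀)
    (hp : Z₂ r₀ * r₀ ^ 2 - (1 - Z₀ - Z₁) * r₀ + Y₀ < 0) :
    ∃! x : X, x ∈ Metric.closedBall x₀ r₀ ∧ G x = 0 := by
  set K : ℝ := Z₀ + Z₁ + Z₂ r₀ * r₀ with hK
  have hK0 : 0 ≤ K := by
    have := mul_nonneg (hZ₂ r₀ hr₀) hr₀.le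
    positivity
  have hKr : K * r₀ + Y₀ < r₀ := by rw [hK]; nlinarith
  have hK1 : K < 1 := by
    by_contra h
    have : 1 * r₀ ≤ K * r₀ := mul_le_mul_of_nonneg_right (not_lt.mp h) hr₀.le
    linarith
  set s := Metric.closedBall x₀ r₀ with hs
  have hx₀ : x₀ ∈ s := Metric.mem_closedBall_self hr₀.le
  let T : X → X := fun x => x - A (G x)
  have hT : ∀ x ∈ s, HasFDerivWithinAt T
      (ContinuousLinearMap.id ℝ X - A.comp (fderiv ℝ G x)) s x := fun x _ =>
    ((hasFDerivAt_id x).sub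
      (A.hasFDerivAt.comp x (hG x).hasFDerivAt)).hasFDerivWithinAt
  have hb : ∀ x ∈ s, ‖ContinuousLinearMap.id ℝ X - A.comp (fderiv ℝ G x)‖ ≤ K := by
    intro x hx
    have e : ContinuousLinearMap.id ℝ X - A.comp (fderiv ℝ G x) =
        (ContinuousLinearMap.id ℝ X - A.comp A') - A.comp (fderiv ℝ G x₀ - A')
          - A.comp (fderiv ℝ G x - fderiv ℝ G x₀) := by
      simp only [ContinuousLinearMap.comp_sub]
      abel
    rw [e]
    have a1 := norm_sub_le ((ContinuousLinearMap.id ℝ X - A.comp A')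
      - A.comp (fderiv ℝ G x₀ - A')) (A.comp (fderiv ℝ G x - fderiv ℝ G x₀))
    have a2 := norm_sub_le (ContinuousLinearMap.id ℝ X - A.comp A')
      (A.comp (fderiv ℝ G x₀ - A'))
    have a3 := h4 r₀ hr₀ x hx
    linarith
  have hL : ∀ x ∈ s, ∀ y ∈ s, ‖T y - T x‖ ≤ K * ‖y - x‖ := fun x hx y hy =>
    (convex_closedBall x₀ r₀).norm_image_sub_le_of_norm_hasFDerivWithin_le hT hb hx hy
  have hm : Set.MapsTo T s s := by
    intro x hx
    have b1 := hL x₀ hx₀ x hx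
    have hx' : ‖x - x₀‖ ≤ r₀ := by rwa [hs, mem_closedBall_iff_norm] at hx
    have b2 : K * ‖x - x₀‖ ≤ K * r₀ := mul_le_mul_of_nonneg_left hx' hK0
    have b3 : T x - x₀ = (T x - T x₀) - A (G x₀) := by simp only [T]; abel
    rw [hs, mem_closedBall_iff_norm, b3]
    have b4 := norm_sub_le (T x - T x₀) (A (G x₀))
    linarith
  have hfix : ∀ x, T x = x ↔ G x = 0 := by
    intro x
    simp only [T, sub_eq_self]
    exact map_eq_zero_iff A hA
  have hc : ContractingWith ⟨K, hK0⟩ (hm.restrict T s s) := by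
    refine ⟨hK1, LipschitzWith.of_dist_le_mul ?_⟩
    intro x y
    have := hL y y.2 x x.2
    rw [← dist_eq_norm, ← dist_eq_norm] at this
    exact this
  obtain ⟨x, hx, hfx, -⟩ := hc.exists_fixedPoint' (Metric.isClosed_closedBall.isComplete) hm hx₀
    (edist_ne_top _ _)
  refine ⟨x, ⟨hx, (hfix x).1 hfx⟩, ?_⟩
  rintro y ⟨hy, hGy⟩
  have h := hL x hx y hy
  rw [(hfix y).2 hGy, hfx.eq] at h
  have h0 : ‖y - x‖ = 0 := by nlinarith [norm_nonneg (y - x)]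
  exact sub_eq_zero.1 (norm_eq_zero.1 h0)
end
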